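/- Fix 0 < R₁ < R₂. There exist constants c > 0, C > 0 and δ₀ ∈ (0, 1) such that for all δ ∈ (0, δ₀): c/|log δ| ≤ λ₁(B_{R₂} \ K_δ) − λ₁(B_{R₂}) ≤ C/|log δ|. (This is the order of the two-term asymptotic expansion of λ₁^{NND} as the cracks close, ε = π/2 − δ → π/2.) -/

import Mathlib

open MeasureTheory Real Set

noncomputable section

/-- A Dirichlet test function on `ω`: smooth, compactly supported, with support in `ω`. -/
def testFun (ω : Set (ℝ × ℝ)) (u : (ℝ × ℝ) → ℝ) : Prop :=
  ContDiff ℝ (⊤ : ℕ∞) u ∧ HasCompactSupport u ∧ tsupport u ⊆ ω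

/-- `|∇u|²` at a point. -/
def gradSq (u : (ℝ × ℝ) → ℝ) (x : ℝ × ℝ) : ℝ :=
  fderiv ℝ u x (1, 0) ^ 2 + fderiv ℝ u x (0, 1) ^ 2

/-- The Rayleigh quotient of `u` on `ω`. -/
def rayleigh (ω : Set (ℝ × ℝ)) (u : (ℝ × ℝ) → ℝ) : ℝ :=
  (∫ x in ω, gradSq u x) / ∫ x in ω, u x ^ 2

/-- The `k`-th Dirichlet eigenvalue of `ω` (`k ≥ 1`), via the Courant–Fischer
min-max formula over `k`-dimensional subspaces of `C_c^∞(ω)`. -/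
def dirichletEV (ω : Set (ℝ × ℝ)) (k : ℕ) : ℝ :=
  sInf {l | ∃ V : Submodule ℝ ((ℝ × ℝ) → ℝ),
    (V : Set ((ℝ × ℝ) → ℝ)) ⊆ {u | testFun ω u} ∧ Module.finrank ℝ V = k ∧
    l = sSup {r | ∃ u ∈ V, u ≠ 0 ∧ r = rayleigh ω u}}

/-- The open disk `B_R` centered at the origin. -/
def disk (R : ℝ) : Set (ℝ × ℝ) := {x | x.1 ^ 2 + x.2 ^ 2 < R ^ 2}

/-- The open annulus `M_{R₁,R₂} = B_{R₂} \ closure (B_{R₁})`. -/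
def annulus (R₁ R₂ : ℝ) : Set (ℝ × ℝ) := disk R₂ \ closure (disk R₁)

/-- `D_{R₁,R₂} = B_{R₁} ∪ M_{R₁,R₂}`. -/
def diskUnionAnnulus (R₁ R₂ : ℝ) : Set (ℝ × ℝ) := disk R₁ ∪ annulus R₁ R₂

/-- The cracked domain `𝔇(N,ε)`. -/
def crackedDomain (R₁ R₂ : ℝ) (N : ℕ) (ε : ℝ) : Set (ℝ × ℝ) :=
  diskUnionAnnulus R₁ R₂ ∪
    ⋃ j ∈ Finset.range N, {x | ∃ θ : ℝ, θ ∈ Set.Ioo (2 * π * j / N - ε) (2 * π * j / N + ε) ∧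
      x = (R₁ * Real.cos θ, R₁ * Real.sin θ)}

/-- The first Dirichlet eigenvalue of `ω`: the infimum of the Rayleigh quotient over
nonzero functions in `C_c^∞(ω)`. -/
def lambda1 (ω : Set (ℝ × ℝ)) : ℝ :=
  sInf {r | ∃ u, testFun ω u ∧ u ≠ 0 ∧ r = rayleigh ω u}

/-- The open upper half-disk `B_R⁺ = B_R ∩ {x₂ > 0}`. -/
def halfDisk (R : ℝ) : Set (ℝ × ℝ) := disk R ∩ {x | 0 < x.2}

/-- The compact set `K_δ`: two closed arcs of angular half-width `δ` on the circle of radius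
`R₁`, centered at the points `(0, R₁)` and `(0, −R₁)`. -/
def crackSet (R₁ δ : ℝ) : Set (ℝ × ℝ) :=
  {x | ∃ θ : ℝ, (θ ∈ Set.Icc (π / 2 - δ) (π / 2 + δ) ∨
      θ ∈ Set.Icc (-(π / 2) - δ) (-(π / 2) + δ)) ∧
    x = (R₁ * Real.cos θ, R₁ * Real.sin θ)}

/-- `K_δ⁺ = K_δ ∩ {x₂ > 0}`. -/
def crackSetPlus (R₁ δ : ℝ) : Set (ℝ × ℝ) := crackSet R₁ δ ∩ {x | 0 < x.2}

/-- The entire function `t ↦ ∑ (-t)^k / (k! (k+n)!)`; for `n = 0` its value at `r² / 4` is the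
Bessel function `J₀(r)`. -/
def besselSeries (n : ℕ) (t : ℝ) : ℝ :=
  ∑' k : ℕ, (-t) ^ k / ((k.factorial : ℝ) * ((k + n).factorial : ℝ))

lemma norm_besselSeries_term_le (n k : ℕ) (t : ℝ) :
    ‖(-t) ^ k / ((k.factorial : ℝ) * ((k + n).factorial : ℝ))‖ ≤ |t| ^ k / k.factorial := by
  rw [norm_div, norm_pow, norm_neg, Real.norm_eq_abs, Real.norm_eq_abs,
    abs_of_pos (a := (k.factorial : ℝ) * ((k + n).factorial : ℝ)) (by positivity)]
  have h1 : (1 : ℝ) ≤ ((k + n).factorial : ℝ) := by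
    exact_mod_cast Nat.one_le_iff_ne_zero.2 (Nat.factorial_ne_zero _)
  have h2 : (0 : ℝ) < (k.factorial : ℝ) := by positivity
  gcongr
  nlinarith

lemma summable_besselSeries (n : ℕ) (t : ℝ) :
    Summable fun k : ℕ => (-t) ^ k / ((k.factorial : ℝ) * ((k + n).factorial : ℝ)) :=
  Summable.of_norm_bounded (Real.summable_pow_div_factorial |t|)
    fun k => norm_besselSeries_term_le n k t

lemma hasDerivAt_besselSeries (n : ℕ) (t : ℝ) :
    HasDerivAt (besselSeries n) (-besselSeries (n + 1) t) t := by
  set R : ℝ := |t| + 1 with hR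
  have hR0 : 0 ≤ R := by positivity
  let g' : ℕ → ℝ → ℝ := fun k y =>
    (k * (-y) ^ (k - 1) * (-1)) / ((k.factorial : ℝ) * ((k + n).factorial : ℝ))
  have hu : Summable fun k : ℕ => (k : ℝ) * R ^ (k - 1) / k.factorial := by
    rw [← summable_nat_add_iff 1]
    refine (Real.summable_pow_div_factorial R).congr fun k => ?_
    rw [Nat.factorial_succ]
    push_cast
    have : (k.factorial : ℝ) ≠ 0 := by positivity
    have : (k : ℝ) + 1 ≠ 0 := by positivity
    field_simp
  have key := hasDerivAt_tsum_of_isPreconnected (𝕜 := ℝ) (F := ℝ)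
    (g := fun k y => (-y) ^ k / ((k.factorial : ℝ) * ((k + n).factorial : ℝ))) (g' := g')
    (t := Metric.ball 0 R) (y₀ := 0) (y := t) hu Metric.isOpen_ball
    (convex_ball (0 : ℝ) R).isPreconnected
    (fun k y _ => by
      have := (((hasDerivAt_id y).neg).pow k).div_const
        ((k.factorial : ℝ) * ((k + n).factorial : ℝ))
      simpa [g'] using this)
    (fun k y hy => by
      have hy' : |y| ≤ R := by simpa using (Metric.mem_ball.1 hy).le
      have h1 : (1 : ℝ) ≤ ((k + n).factorial : ℝ) := by
        exact_mod_cast Nat.one_le_iff_ne_zero.2 (Nat.factorial_ne_zero _)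
      have h2 : (0 : ℝ) < (k.factorial : ℝ) := by positivity
      have h3 : (k.factorial : ℝ) ≤ (k.factorial : ℝ) * ((k + n).factorial : ℝ) := by nlinarith
      simp only [g', norm_div, norm_mul, norm_pow, norm_neg, norm_one, mul_one, Real.norm_eq_abs,
        Nat.abs_cast]
      gcongr)
    (Metric.mem_ball_self (by positivity)) (summable_besselSeries n 0)
    (by simp [hR])
  refine key.congr_deriv ?_
  have hs : Summable fun k => g' k t := by
    rw [← summable_nat_add_iff 1]
    refine ((summable_besselSeries (n + 1) t).neg).congr fun k => ?_
    simp only [g', Nat.add_sub_cancel]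
    rw [Nat.factorial_succ k, show k + 1 + n = k + (n + 1) by ring]
    push_cast
    have : (k.factorial : ℝ) ≠ 0 := by positivity
    have : (k : ℝ) + 1 ≠ 0 := by positivity
    field_simp
  rw [hs.tsum_eq_zero_add, besselSeries, ← tsum_neg]
  have h0 : g' 0 t = 0 := by simp [g']
  rw [h0, zero_add]
  refine tsum_congr fun k => ?_
  simp only [g', Nat.add_sub_cancel]
  rw [Nat.factorial_succ k, show k + 1 + n = k + (n + 1) by ring]
  push_cast
  have : (k.factorial : ℝ) ≠ 0 := by positivity
  have : (k : ℝ) + 1 ≠ 0 := by positivity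
  field_simp

lemma besselSeries_recurrence (t : ℝ) :
    besselSeries 0 t = besselSeries 1 t - t * besselSeries 2 t := by
  unfold besselSeries
  rw [(summable_besselSeries 0 t).tsum_eq_zero_add, (summable_besselSeries 1 t).tsum_eq_zero_add,
    add_sub_assoc, ← tsum_mul_left, ← Summable.tsum_sub]
  · congr 1
    refine tsum_congr fun k => ?_
    simp only [show k + 1 + 0 = k + 1 by ring, show k + 1 + 1 = k + 2 by ring, Nat.factorial_succ]
    push_cast
    have : (k.factorial : ℝ) ≠ 0 := by positivity
    have : (k : ℝ) + 1 ≠ 0 := by positivity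
    have : (k : ℝ) + 1 + 1 ≠ 0 := by positivity
    field_simp
    ring
  · exact (summable_nat_add_iff 1).2 (summable_besselSeries 1 t)
  · exact (summable_besselSeries 2 t).mul_left t

lemma contDiff_besselSeries (n : ℕ) : ContDiff ℝ (⊤ : ℕ∞) (besselSeries n) := by
  have key : ∀ m n : ℕ, ContDiff ℝ m (besselSeries n) := by
    intro m
    induction m with
    | zero =>
      intro n
      exact contDiff_zero.2 (continuous_iff_continuousAt.2 fun t =>
        (hasDerivAt_besselSeries n t).continuousAt)
    | succ m ih =>
      intro n
      push_cast
      refine contDiff_succ_iff_deriv.2 ⟨fun t => (hasDerivAt_besselSeries n t).differentiableAt,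
        by simp, ?_⟩
      rw [show deriv (besselSeries n) = fun t => -besselSeries (n + 1) t from
        funext fun t => (hasDerivAt_besselSeries n t).deriv]
      exact (ih (n + 1)).neg
  exact contDiff_infty.2 fun m => key m n

lemma besselSeries_zero (n : ℕ) : besselSeries n 0 = 1 / n.factorial := by
  unfold besselSeries
  rw [tsum_eq_single 0 fun k hk => by simp [hk]]
  simp

lemma besselSeries_zero_two_neg : besselSeries 0 2 < 0 := by
  have hs := summable_besselSeries 0 2
  unfold besselSeries
  rw [← hs.sum_add_tsum_nat_add 4]
  have hb : ∑' k : ℕ, (-2 : ℝ) ^ (k + 4) / (((k + 4).factorial : ℝ) * ((k + 4 + 0).factorial : ℝ))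
      ≤ ∑' k : ℕ, (1 / 16 : ℝ) * (1 / 2) ^ k := by
    refine Summable.tsum_le_tsum (fun k => ?_) ((summable_nat_add_iff 4).2 hs)
      (summable_geometric_two.mul_left _)
    have hf : ∀ k : ℕ, (2 : ℝ) ^ (k + 4) ≤ ((k + 4).factorial : ℝ) := by
      intro k
      induction k with
      | zero => norm_num [Nat.factorial]
      | succ k ih =>
        rw [show k + 1 + 4 = (k + 4) + 1 by ring, pow_succ, Nat.factorial_succ]
        push_cast
        have : (0 : ℝ) ≤ k := by positivity
        nlinarith [show (0 : ℝ) ≤ (k + 4).factorial by positivity]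
    have h2 : (0 : ℝ) < 2 ^ (k + 4) := by positivity
    calc (-2 : ℝ) ^ (k + 4) / (((k + 4).factorial : ℝ) * ((k + 4 + 0).factorial : ℝ))
        ≤ |(-2 : ℝ) ^ (k + 4)| / (((k + 4).factorial : ℝ) * ((k + 4 + 0).factorial : ℝ)) := by
          gcongr; exact le_abs_self _
      _ = 2 ^ (k + 4) / (((k + 4).factorial : ℝ) * ((k + 4).factorial : ℝ)) := by
          rw [abs_pow]; norm_num
      _ ≤ 2 ^ (k + 4) / (2 ^ (k + 4) * 2 ^ (k + 4)) := by
          gcongr <;> exact hf k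
      _ = (1 / 16 : ℝ) * (1 / 2) ^ k := by
          rw [pow_add, one_div_pow]; field_simp; norm_num
  rw [tsum_mul_left, tsum_geometric_two] at hb
  norm_num [Finset.sum_range_succ, Nat.factorial] at hb ⊢
  linarith

/-- The first zero of `besselSeries 0`, with two-sided linear bounds up to that zero. -/
lemma exists_first_zero_besselSeries : ∃ t₀ m M : ℝ, 0 < t₀ ∧ 0 < m ∧ 0 < M ∧
    ∀ s ∈ Icc 0 t₀, m * (t₀ - s) ≤ besselSeries 0 s ∧ besselSeries 0 s ≤ M * (t₀ - s) := by
  have hcont : ∀ n, Continuous (besselSeries n) := fun n => (contDiff_besselSeries n).continuous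
  set Z : Set ℝ := Ici 0 ∩ besselSeries 0 ⁻¹' {0} with hZ
  have hZc : IsClosed Z := isClosed_Ici.inter (isClosed_singleton.preimage (hcont 0))
  have h00 : besselSeries 0 0 = 1 := by simp [besselSeries_zero]
  have hZn : Z.Nonempty := by
    obtain ⟨t, ht, h⟩ := intermediate_value_Icc' (by norm_num : (0 : ℝ) ≤ 2)
      (hcont 0).continuousOn
      (show (0 : ℝ) ∈ Icc (besselSeries 0 2) (besselSeries 0 0) from
        ⟨besselSeries_zero_two_neg.le, by rw [h00]; norm_num⟩)
    exact ⟨t, ht.1, h⟩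
  have hZb : BddBelow Z := ⟨0, fun x hx => hx.1⟩
  set t₀ := sInf Z
  have ht₀ : t₀ ∈ Z := hZc.csInf_mem hZn hZb
  have hz : besselSeries 0 t₀ = 0 := ht₀.2
  have hpos : 0 < t₀ := by
    refine lt_of_le_of_ne ht₀.1 fun h => ?_
    rw [← h, h00] at hz
    norm_num at hz
  have hJpos : ∀ s, 0 ≤ s → s < t₀ → 0 < besselSeries 0 s := by
    intro s hs hst
    by_contra hneg
    obtain ⟨t, ht, h⟩ := intermediate_value_Icc' hs (hcont 0).continuousOn
      (show (0 : ℝ) ∈ Icc (besselSeries 0 s) (besselSeries 0 0) from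
        ⟨not_lt.1 hneg, by rw [h00]; norm_num⟩)
    exact absurd (csInf_le hZb (show t ∈ Z from ⟨ht.1, h⟩)) (not_le.2 (ht.2.trans_lt hst))
  have hder : ∀ t, HasDerivAt (fun t => -(t * besselSeries 1 t)) (-besselSeries 0 t) t := by
    intro t
    have := ((hasDerivAt_id t).mul (hasDerivAt_besselSeries 1 t)).neg
    refine this.congr_deriv ?_
    rw [besselSeries_recurrence]
    simp only [id]
    ring
  have hanti : StrictAntiOn (fun t => -(t * besselSeries 1 t)) (Icc 0 t₀) := by
    refine strictAntiOn_of_deriv_neg (convex_Icc _ _)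
      (continuous_iff_continuousAt.2 fun t => (hder t).continuousAt).continuousOn fun t ht => ?_
    rw [interior_Icc] at ht
    rw [(hder t).deriv]
    linarith [hJpos t ht.1.le ht.2]
  have hB1 : ∀ t ∈ Icc 0 t₀, 0 < besselSeries 1 t := by
    intro t ht
    rcases ht.1.eq_or_lt with h | h
    · rw [← h, besselSeries_zero]; norm_num
    · have := hanti (left_mem_Icc.2 hpos.le) ht h
      simp only [zero_mul, neg_zero, neg_lt_zero] at this
      exact (mul_pos_iff_of_pos_left h).1 this
  obtain ⟨a, ha, hmin⟩ := isCompact_Icc.exists_isMinOn (nonempty_Icc.2 hpos.le)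
    (hcont 1).continuousOn
  obtain ⟨b, hb, hmax⟩ := isCompact_Icc.exists_isMaxOn (nonempty_Icc.2 hpos.le)
    (hcont 1).continuousOn
  refine ⟨t₀, besselSeries 1 a, besselSeries 1 b, hpos, hB1 a ha, hB1 b hb, fun s hs => ?_⟩
  have hd : DifferentiableOn ℝ (besselSeries 0) (interior (Icc 0 t₀)) := fun t _ =>
    (hasDerivAt_besselSeries 0 t).differentiableAt.differentiableWithinAt
  have h1 := (convex_Icc 0 t₀).image_sub_le_mul_sub_of_deriv_le (hcont 0).continuousOn hd
    (C := -besselSeries 1 a) (fun t ht => by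
      rw [(hasDerivAt_besselSeries 0 t).deriv]
      exact neg_le_neg (hmin (interior_subset ht))) s hs t₀ (right_mem_Icc.2 hpos.le) hs.2
  have h2 := (convex_Icc 0 t₀).mul_sub_le_image_sub_of_le_deriv (hcont 0).continuousOn hd
    (C := -besselSeries 1 b) (fun t ht => by
      rw [(hasDerivAt_besselSeries 0 t).deriv]
      exact neg_le_neg (hmax (interior_subset ht))) s hs t₀ (right_mem_Icc.2 hpos.le) hs.2
  rw [hz] at h1 h2
  constructor <;> linarith

lemma continuous_gradSq {u : ℝ × ℝ → ℝ} (hu : ContDiff ℝ (⊤ : ℕ∞) u) : Continuous (gradSq u) := by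
  have h := hu.continuous_fderiv (by simp)
  unfold gradSq
  fun_prop

lemma hasCompactSupport_gradSq {u : ℝ × ℝ → ℝ} (hu : HasCompactSupport u) :
    HasCompactSupport (gradSq u) :=
  (hu.fderiv ℝ).comp_left (g := fun L : ℝ × ℝ →L[ℝ] ℝ => L (1, 0) ^ 2 + L (0, 1) ^ 2) (by simp)

lemma gradSq_nonneg (u : ℝ × ℝ → ℝ) (x : ℝ × ℝ) : 0 ≤ gradSq u x := by
  unfold gradSq; positivity

lemma integral_fderiv_apply_eq_zero {g : ℝ × ℝ → ℝ} (hg : ContDiff ℝ 1 g)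
    (hc : HasCompactSupport g) (v : ℝ × ℝ) : ∫ x, fderiv ℝ g x v = 0 := by
  have h1 : Continuous fun x => fderiv ℝ g x v :=
    (hg.continuous_fderiv (by simp)).clm_apply continuous_const
  have h := integral_mul_fderiv_eq_neg_fderiv_mul_of_integrable (μ := (volume : Measure (ℝ × ℝ)))
    (f := fun _ => (1 : ℝ)) (g := g) (v := v) (by simp)
    (by simpa using h1.integrable_of_hasCompactSupport (hc.fderiv_apply ℝ v))
    (by simpa using hg.continuous.integrable_of_hasCompactSupport hc)
    (fun x _ => by fun_prop) (fun x _ => (hg.differentiable (by simp)).differentiableAt)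
  simpa using h

lemma gradSq_mul_eq {φ w : ℝ × ℝ → ℝ} {l : ℝ} (hφ : ContDiff ℝ (⊤ : ℕ∞) φ)
    (hw : ContDiff ℝ (⊤ : ℕ∞) w)
    (hΔ : ∀ x, fderiv ℝ (fun y => fderiv ℝ φ y (1, 0)) x (1, 0) +
      fderiv ℝ (fun y => fderiv ℝ φ y (0, 1)) x (0, 1) = -l * φ x) (x : ℝ × ℝ) :
    gradSq (fun y => φ y * w y) x =
      (l * (φ x * w x) ^ 2 + φ x ^ 2 * gradSq w x) +
      (fderiv ℝ (fun y => φ y * w y ^ 2 * fderiv ℝ φ y (1, 0)) x (1, 0) +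
      fderiv ℝ (fun y => φ y * w y ^ 2 * fderiv ℝ φ y (0, 1)) x (0, 1)) := by
  have hd : ∀ v, ContDiff ℝ (⊤ : ℕ∞) fun y => fderiv ℝ φ y v := fun v =>
    (hφ.fderiv_right (m := (⊤ : ℕ∞)) (by simp)).clm_apply contDiff_const
  have hφx : HasFDerivAt φ (fderiv ℝ φ x) x := (hφ.differentiable (by simp) x).hasFDerivAt
  have hwx : HasFDerivAt w (fderiv ℝ w x) x := (hw.differentiable (by simp) x).hasFDerivAt
  have hdx : ∀ v, HasFDerivAt (fun y => fderiv ℝ φ y v)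
    (fderiv ℝ (fun y => fderiv ℝ φ y v) x) x := fun v =>
    ((hd v).differentiable (by simp) x).hasFDerivAt
  have e : ∀ v, fderiv ℝ (fun y => φ y * w y ^ 2 * fderiv ℝ φ y v) x v =
      φ x * w x ^ 2 * fderiv ℝ (fun y => fderiv ℝ φ y v) x v +
      fderiv ℝ φ x v * (φ x * (2 * w x * fderiv ℝ w x v) + w x ^ 2 * fderiv ℝ φ x v) := by
    intro v
    rw [((hφx.fun_mul (hwx.pow 2)).fun_mul (hdx v)).fderiv]
    simp
    ring
  have e2 : ∀ v, fderiv ℝ (fun y => φ y * w y) x v =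
      φ x * fderiv ℝ w x v + w x * fderiv ℝ φ x v := by
    intro v
    rw [(hφx.fun_mul hwx).fderiv]
    simp
  rw [e, e]
  unfold gradSq
  rw [e2, e2]
  linear_combination (-φ x * w x ^ 2) * hΔ x

/-- Ground state substitution: if `-Δφ = l φ` then
`∫ |∇(φ w)|² = l ∫ (φ w)² + ∫ φ² |∇w|²`. -/
lemma integral_gradSq_mul {φ w : ℝ × ℝ → ℝ} {l : ℝ} (hφ : ContDiff ℝ (⊤ : ℕ∞) φ)
    (hw : ContDiff ℝ (⊤ : ℕ∞) w) (hc : HasCompactSupport w)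
    (hΔ : ∀ x, fderiv ℝ (fun y => fderiv ℝ φ y (1, 0)) x (1, 0) +
      fderiv ℝ (fun y => fderiv ℝ φ y (0, 1)) x (0, 1) = -l * φ x) :
    ∫ x, gradSq (fun y => φ y * w y) x =
      l * (∫ x, (φ x * w x) ^ 2) + ∫ x, φ x ^ 2 * gradSq w x := by
  have hd : ∀ v, ContDiff ℝ (⊤ : ℕ∞) fun y => fderiv ℝ φ y v := fun v =>
    (hφ.fderiv_right (m := (⊤ : ℕ∞)) (by simp)).clm_apply contDiff_const
  have hg : ∀ v, ContDiff ℝ 1 fun y => φ y * w y ^ 2 * fderiv ℝ φ y v := fun v =>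
    ((hφ.mul (hw.pow 2)).mul (hd v)).of_le (by simp)
  have hgc : ∀ v, HasCompactSupport fun y => φ y * w y ^ 2 * fderiv ℝ φ y v := fun v =>
    hc.mono fun x hx => by
      simp only [Function.mem_support] at hx ⊢
      contrapose! hx
      simp [hx]
  have h0 := integral_fderiv_apply_eq_zero (hg (1, 0)) (hgc _) (1, 0)
  have h1 := integral_fderiv_apply_eq_zero (hg (0, 1)) (hgc _) (0, 1)
  have hi : ∀ v, Integrable (fun x => fderiv ℝ (fun y => φ y * w y ^ 2 * fderiv ℝ φ y v) x v) :=
    fun v => (((hg v).continuous_fderiv (by simp)).clm_apply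
      continuous_const).integrable_of_hasCompactSupport ((hgc v).fderiv_apply ℝ v)
  have hgrad := continuous_gradSq hw
  have hgradc := hasCompactSupport_gradSq hc
  have c1 : Continuous fun x => (φ x * w x) ^ 2 := by
    have := hφ.continuous
    have := hw.continuous
    fun_prop
  have c2 : HasCompactSupport fun x => (φ x * w x) ^ 2 := hc.mono fun x hx => by
    simp only [Function.mem_support] at hx ⊢
    contrapose! hx
    simp [hx]
  have i1 : Integrable fun x => (φ x * w x) ^ 2 := c1.integrable_of_hasCompactSupport c2
  have i2 : Integrable fun x => φ x ^ 2 * gradSq w x :=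
    ((hφ.continuous.pow 2).mul hgrad).integrable_of_hasCompactSupport hgradc.mul_left
  have i3 := i1.const_mul l
  calc ∫ x, gradSq (fun y => φ y * w y) x
      = ∫ x, ((l * (φ x * w x) ^ 2 + φ x ^ 2 * gradSq w x) +
          (fderiv ℝ (fun y => φ y * w y ^ 2 * fderiv ℝ φ y (1, 0)) x (1, 0) +
          fderiv ℝ (fun y => φ y * w y ^ 2 * fderiv ℝ φ y (0, 1)) x (0, 1))) :=
        integral_congr_ae (.of_forall fun x => gradSq_mul_eq hφ hw hΔ x)
    _ = (∫ x, (l * (φ x * w x) ^ 2 + φ x ^ 2 * gradSq w x)) +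
          ∫ x, (fderiv ℝ (fun y => φ y * w y ^ 2 * fderiv ℝ φ y (1, 0)) x (1, 0) +
          fderiv ℝ (fun y => φ y * w y ^ 2 * fderiv ℝ φ y (0, 1)) x (0, 1)) :=
        integral_add (i3.add i2) ((hi (1, 0)).add (hi (0, 1)))
    _ = l * (∫ x, (φ x * w x) ^ 2) + ∫ x, φ x ^ 2 * gradSq w x := by
        rw [integral_add (hi (1, 0)) (hi (0, 1)), h0, h1, integral_add i3 i2, integral_const_mul,
          add_zero, add_zero]

/-- The radial function `x ↦ J₀(2 √κ |x|)`. -/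
def groundState (κ : ℝ) (x : ℝ × ℝ) : ℝ := besselSeries 0 (κ * (x.1 ^ 2 + x.2 ^ 2))

lemma contDiff_groundState (κ : ℝ) : ContDiff ℝ (⊤ : ℕ∞) (groundState κ) := by
  refine (contDiff_besselSeries 0).comp (g := besselSeries 0)
    (f := fun x : ℝ × ℝ => κ * (x.1 ^ 2 + x.2 ^ 2)) ?_
  fun_prop

lemma hasFDerivAt_comp_sq {f : ℝ → ℝ} {f' κ : ℝ} {x : ℝ × ℝ}
    (hf : HasDerivAt f f' (κ * (x.1 ^ 2 + x.2 ^ 2))) :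
    HasFDerivAt (fun y : ℝ × ℝ => f (κ * (y.1 ^ 2 + y.2 ^ 2)))
      ((2 * κ * f') • (x.1 • ContinuousLinearMap.fst ℝ ℝ ℝ +
        x.2 • ContinuousLinearMap.snd ℝ ℝ ℝ)) x := by
  have h1 : HasFDerivAt (fun y : ℝ × ℝ => y.1) (ContinuousLinearMap.fst ℝ ℝ ℝ) x := hasFDerivAt_fst
  have h2 : HasFDerivAt (fun y : ℝ × ℝ => y.2) (ContinuousLinearMap.snd ℝ ℝ ℝ) x := hasFDerivAt_snd
  refine (hf.comp_hasFDerivAt (f := fun y : ℝ × ℝ => κ * (y.1 ^ 2 + y.2 ^ 2)) x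
    (((h1.pow 2).add (h2.pow 2)).const_mul κ)).congr_fderiv ?_
  ext <;> simp <;> ring

lemma laplacian_groundState (κ : ℝ) (x : ℝ × ℝ) :
    fderiv ℝ (fun y => fderiv ℝ (groundState κ) y (1, 0)) x (1, 0) +
      fderiv ℝ (fun y => fderiv ℝ (groundState κ) y (0, 1)) x (0, 1) =
        -(4 * κ) * groundState κ x := by
  have h1 : HasFDerivAt (fun y : ℝ × ℝ => y.1) (ContinuousLinearMap.fst ℝ ℝ ℝ) x := hasFDerivAt_fst
  have h2 : HasFDerivAt (fun y : ℝ × ℝ => y.2) (ContinuousLinearMap.snd ℝ ℝ ℝ) x := hasFDerivAt_snd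
  have hB := hasFDerivAt_comp_sq (κ := κ) (x := x) (hasDerivAt_besselSeries 1 _)
  have e1 : (fun y => fderiv ℝ (groundState κ) y (1, 0)) =
      fun y => (-(2 * κ) * y.1) * besselSeries 1 (κ * (y.1 ^ 2 + y.2 ^ 2)) := by
    funext y
    have := (hasFDerivAt_comp_sq (κ := κ) (x := y) (hasDerivAt_besselSeries 0 _)).fderiv
    unfold groundState
    rw [this]
    simp
    ring
  have e2 : (fun y => fderiv ℝ (groundState κ) y (0, 1)) =
      fun y => (-(2 * κ) * y.2) * besselSeries 1 (κ * (y.1 ^ 2 + y.2 ^ 2)) := by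
    funext y
    have := (hasFDerivAt_comp_sq (κ := κ) (x := y) (hasDerivAt_besselSeries 0 _)).fderiv
    unfold groundState
    rw [this]
    simp
    ring
  rw [e1, e2, ((h1.const_mul (-(2 * κ))).fun_mul hB).fderiv,
    ((h2.const_mul (-(2 * κ))).fun_mul hB).fderiv,
    groundState, besselSeries_recurrence]
  simp
  ring

lemma integral_gradSq_groundState_mul (κ : ℝ) {w : ℝ × ℝ → ℝ}
    (hw : ContDiff ℝ (⊤ : ℕ∞) w) (hc : HasCompactSupport w) :
    ∫ x, gradSq (fun y => groundState κ y * w y) x =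
      4 * κ * (∫ x, (groundState κ x * w x) ^ 2) + ∫ x, groundState κ x ^ 2 * gradSq w x :=
  integral_gradSq_mul (contDiff_groundState κ) hw hc (laplacian_groundState κ)

lemma rayleigh_eq {ω : Set (ℝ × ℝ)} {u : ℝ × ℝ → ℝ} (hu : testFun ω u) :
    rayleigh ω u = (∫ x, gradSq u x) / ∫ x, u x ^ 2 := by
  have h0 : ∀ x ∉ ω, x ∉ tsupport u := fun x hx h => hx (hu.2.2 h)
  unfold rayleigh
  rw [setIntegral_eq_integral_of_forall_compl_eq_zero fun x hx => by
      have := image_eq_zero_of_notMem_tsupport (f := fderiv ℝ u)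
        (fun h => h0 x hx (tsupport_fderiv_subset ℝ h))
      simp [gradSq, this],
    setIntegral_eq_integral_of_forall_compl_eq_zero fun x hx => by
      simp [image_eq_zero_of_notMem_tsupport (h0 x hx)]]

lemma integral_sq_pos {u : ℝ × ℝ → ℝ} (hu : Continuous u) (hc : HasCompactSupport u) (h0 : u ≠ 0) :
    0 < ∫ x, u x ^ 2 := by
  obtain ⟨x, hx⟩ := Function.ne_iff.1 h0
  refine (hu.pow 2).integral_pos_of_hasCompactSupport_nonneg_nonzero
    (hc.comp_left (g := fun t : ℝ => t ^ 2) (by simp)) (fun x => sq_nonneg _) (x := x) ?_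
  exact pow_ne_zero 2 hx

lemma bddBelow_rayleigh (ω : Set (ℝ × ℝ)) :
    BddBelow {r | ∃ u, testFun ω u ∧ u ≠ 0 ∧ r = rayleigh ω u} := by
  refine ⟨0, ?_⟩
  rintro r ⟨u, -, -, rfl⟩
  exact div_nonneg (integral_nonneg fun x => gradSq_nonneg u x)
    (integral_nonneg fun x => sq_nonneg _)

/-- A test function is the product of a positive smooth function and a test function. -/
lemma exists_eq_mul_of_testFun {ω : Set (ℝ × ℝ)} {u φ : ℝ × ℝ → ℝ} (hu : testFun ω u)
    (hφ : ContDiff ℝ (⊤ : ℕ∞) φ) (hpos : ∀ x ∈ ω, φ x ≠ 0) :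
    ∃ w, testFun ω w ∧ u = fun x => φ x * w x := by
  have hsub : tsupport (fun x => u x / φ x) ⊆ tsupport u :=
    closure_mono fun x hx => by
      simp only [Function.mem_support] at hx ⊢
      contrapose! hx
      simp [hx]
  refine ⟨fun x => u x / φ x, ⟨contDiff_iff_contDiffAt.2 fun x => ?_, ?_, hsub.trans hu.2.2⟩, ?_⟩
  · by_cases hx : x ∈ tsupport u
    · exact hu.1.contDiffAt.div hφ.contDiffAt (hpos x (hu.2.2 hx))
    · have h := notMem_tsupport_iff_eventuallyEq.1 fun h => hx (hsub h)
      exact contDiffAt_const.congr_of_eventuallyEq h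
  · exact hu.2.1.of_isClosed_subset (isClosed_tsupport _) hsub
  · funext x
    by_cases hx : x ∈ tsupport u
    · rw [mul_div_cancel₀ _ (hpos x (hu.2.2 hx))]
    · simp [image_eq_zero_of_notMem_tsupport hx]

lemma integral_eq_polar {f : ℝ × ℝ → ℝ} (hf : Continuous f) {R : ℝ} (hR : 0 < R)
    (h0 : ∀ x : ℝ × ℝ, R ^ 2 ≤ x.1 ^ 2 + x.2 ^ 2 → f x = 0) :
    ∫ x, f x = ∫ r in 0..R, ∫ θ in -π..π, r * f (r * Real.cos θ, r * Real.sin θ) := by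
  have hg : Continuous fun p : ℝ × ℝ => p.1 * f (p.1 * Real.cos p.2, p.1 * Real.sin p.2) := by
    fun_prop
  have hpi : -π ≤ π := by linarith [Real.pi_pos]
  have hsub : Ioc 0 R ×ˢ Ioo (-π) π ⊆ polarCoord.target :=
    prod_mono Ioc_subset_Ioi_self Subset.rfl
  rw [← integral_comp_polarCoord_symm f,
    setIntegral_eq_of_subset_of_forall_sdiff_eq_zero polarCoord.open_target.measurableSet hsub]
  · rw [intervalIntegral.integral_of_le hR.le, Measure.volume_eq_prod]
    refine (setIntegral_prod
      (fun p : ℝ × ℝ => p.1 * f (p.1 * Real.cos p.2, p.1 * Real.sin p.2)) ?_).trans ?_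
    · exact (hg.continuousOn.integrableOn_compact
        (isCompact_Icc.prod isCompact_Icc)).mono_set
        (prod_mono Ioc_subset_Icc_self Ioo_subset_Icc_self)
    · refine integral_congr_ae (.of_forall fun r => ?_)
      simp only
      rw [intervalIntegral.integral_of_le hpi, integral_Ioc_eq_integral_Ioo]
  · rintro ⟨r, θ⟩ ⟨⟨h1, h2⟩, h3⟩
    have hr : R < r := by
      by_contra h
      exact h3 ⟨⟨h1, not_lt.1 h⟩, h2⟩
    simp only [polarCoord_symm_apply, smul_eq_mul]
    rw [h0, mul_zero]
    simp only [mul_pow, ← mul_add, Real.cos_sq_add_sin_sq, mul_one]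
    gcongr

lemma intervalIntegral_swap_of_continuous {F : ℝ → ℝ → ℝ} (hF : Continuous F.uncurry)
    (a b c d : ℝ) : ∫ x in a..b, ∫ y in c..d, F x y = ∫ y in c..d, ∫ x in a..b, F x y :=
  intervalIntegral_intervalIntegral_swap <| (hF.continuousOn.integrableOn_compact
    (isCompact_uIcc.prod isCompact_uIcc)).mono_set
      (prod_mono uIoc_subset_uIcc uIoc_subset_uIcc)

lemma sq_intervalIntegral_le {a b : ℝ} (hab : a ≤ b) {f σ : ℝ → ℝ} (hf : Continuous f)
    (hσ : Continuous σ) (hpos : ∀ x ∈ Icc a b, 0 < σ x) :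
    (∫ x in a..b, f x) ^ 2 ≤ (∫ x in a..b, (σ x)⁻¹) * ∫ x in a..b, σ x * f x ^ 2 := by
  have hi : IntervalIntegrable (fun x => (σ x)⁻¹) volume a b :=
    (hσ.continuousOn.inv₀ fun x hx => (hpos x (by rwa [uIcc_of_le hab] at hx)).ne'
      ).intervalIntegrable
  have hf' : IntervalIntegrable f volume a b := hf.intervalIntegrable _ _
  have hs : IntervalIntegrable (fun x => σ x * f x ^ 2) volume a b :=
    (hσ.mul (hf.pow 2)).intervalIntegrable _ _
  have key : ∀ c : ℝ, 0 ≤ (∫ x in a..b, (σ x)⁻¹) * (c * c) + (-2 * ∫ x in a..b, f x) * c +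
      ∫ x in a..b, σ x * f x ^ 2 := by
    intro c
    have h : 0 ≤ ∫ x in a..b, ((σ x)⁻¹ * (c * c) + (-2 * f x) * c + σ x * f x ^ 2) := by
      refine intervalIntegral.integral_nonneg hab fun x hx => ?_
      have := hpos x hx
      have e : (σ x)⁻¹ * (c * c) + (-2 * f x) * c + σ x * f x ^ 2 =
          σ x * (f x - c * (σ x)⁻¹) ^ 2 := by
        field_simp
        ring
      rw [e]
      positivity
    rwa [intervalIntegral.integral_add ((hi.mul_const _).add ((hf'.const_mul _).mul_const _)) hs,
      intervalIntegral.integral_add (hi.mul_const _) ((hf'.const_mul _).mul_const _),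
      intervalIntegral.integral_mul_const, intervalIntegral.integral_mul_const,
      intervalIntegral.integral_const_mul] at h
  have := discrim_le_zero key
  unfold discrim at this
  nlinarith

lemma integral_inv_affine {a b δ T : ℝ} (hab : a ≤ b) (hδ : 0 < δ) (hT : 0 < T) :
    ∫ r in a..b, (δ + T * (r - a))⁻¹ = Real.log ((δ + T * (b - a)) / δ) / T := by
  have hpos : ∀ r ∈ uIcc a b, 0 < δ + T * (r - a) := by
    intro r hr
    rw [uIcc_of_le hab] at hr
    have := mul_nonneg hT.le (sub_nonneg.2 hr.1)
    linarith
  rw [intervalIntegral.integral_eq_sub_of_hasDerivAt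
    (f := fun r => Real.log (δ + T * (r - a)) / T)]
  · rw [Real.log_div (hpos b right_mem_uIcc).ne' hδ.ne']
    simp
    ring
  · intro r hr
    have h1 : HasDerivAt (fun r => δ + T * (r - a)) T r := by
      simpa using (((hasDerivAt_id r).sub_const a).const_mul T).const_add δ
    refine ((h1.log (hpos r hr).ne').div_const T).congr_deriv ?_
    have := (hpos r hr).ne'
    field_simp
  · refine ContinuousOn.intervalIntegrable ?_
    refine ContinuousOn.inv₀ (by fun_prop) fun r hr => (hpos r hr).ne'

lemma hasDerivAt_polar_curve {w : ℝ × ℝ → ℝ} (hw : Differentiable ℝ w) {θ : ℝ → ℝ} {θ' r : ℝ}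
    (hθ : HasDerivAt θ θ' r) :
    HasDerivAt (fun r => w (r * Real.cos (θ r), r * Real.sin (θ r)))
      ((Real.cos (θ r) - r * θ' * Real.sin (θ r)) *
          fderiv ℝ w (r * Real.cos (θ r), r * Real.sin (θ r)) (1, 0) +
        (Real.sin (θ r) + r * θ' * Real.cos (θ r)) *
          fderiv ℝ w (r * Real.cos (θ r), r * Real.sin (θ r)) (0, 1)) r := by
  have h1 : HasDerivAt (fun r => r * Real.cos (θ r))
      (Real.cos (θ r) - r * θ' * Real.sin (θ r)) r := by
    refine ((hasDerivAt_id r).mul hθ.cos).congr_deriv ?_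
    simp only [id]
    ring
  have h2 : HasDerivAt (fun r => r * Real.sin (θ r))
      (Real.sin (θ r) + r * θ' * Real.cos (θ r)) r := by
    refine ((hasDerivAt_id r).mul hθ.sin).congr_deriv ?_
    simp only [id]
    ring
  have h := (hw (r * Real.cos (θ r), r * Real.sin (θ r))).hasFDerivAt.comp_hasDerivAt r
    (h1.prodMk h2)
  refine h.congr_deriv ?_
  set a := Real.cos (θ r) - r * θ' * Real.sin (θ r)
  set b := Real.sin (θ r) + r * θ' * Real.cos (θ r)
  rw [show (a, b) = a • ((1, 0) : ℝ × ℝ) + b • ((0, 1) : ℝ × ℝ) by simp, map_add, map_smul,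
    map_smul, smul_eq_mul, smul_eq_mul]

lemma sq_polar_curve_deriv_le (a b c θ : ℝ) :
    ((Real.cos θ - c * Real.sin θ) * a + (Real.sin θ + c * Real.cos θ) * b) ^ 2 ≤
      (1 + c ^ 2) * (a ^ 2 + b ^ 2) := by
  have h := Real.sin_sq_add_cos_sq θ
  have e : (1 + c ^ 2) * (a ^ 2 + b ^ 2) =
      ((Real.cos θ - c * Real.sin θ) * a + (Real.sin θ + c * Real.cos θ) * b) ^ 2 +
      ((Real.cos θ - c * Real.sin θ) * b - (Real.sin θ + c * Real.cos θ) * a) ^ 2 := by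
    linear_combination (-(1 + c ^ 2) * (a ^ 2 + b ^ 2)) * h
  rw [e]
  nlinarith [sq_nonneg ((Real.cos θ - c * Real.sin θ) * b - (Real.sin θ + c * Real.cos θ) * a)]

lemma periodic_polar (f : ℝ × ℝ → ℝ) (r : ℝ) :
    Function.Periodic (fun θ => f (r * Real.cos θ, r * Real.sin θ)) (2 * π) := fun θ => by
  simp [Real.cos_add_two_pi, Real.sin_add_two_pi]

lemma integral_polar_shift (f : ℝ × ℝ → ℝ) (r : ℝ) :
    ∫ θ in (π / 2 - π)..(π / 2 + π), f (r * Real.cos θ, r * Real.sin θ) =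
      ∫ θ in -π..π, f (r * Real.cos θ, r * Real.sin θ) := by
  have := (periodic_polar f r).intervalIntegral_add_eq (π / 2 - π) (-π)
  rwa [show π / 2 - π + 2 * π = π / 2 + π by ring, show -π + 2 * π = π by ring] at this

/-- If `w` vanishes on an arc of half-width `δ` of the circle of radius `R₁`, its mean square on the
circle of radius `r₀` is controlled by `log (π / δ)` times its Dirichlet energy between the circles:
integrate along the curves of a fan which opens from the arc to the whole circle. -/
lemma integral_sq_circle_le {w : ℝ × ℝ → ℝ} (hw : ContDiff ℝ (⊤ : ℕ∞) w) {R₁ r₀ δ T : ℝ}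
    (hR₁ : 0 < R₁) (hr₀ : R₁ < r₀) (hδ : 0 < δ) (hT : 0 < T) (hTe : δ + T * (r₀ - R₁) = π)
    (hz : ∀ θ ∈ Icc (π / 2 - δ) (π / 2 + δ), w (R₁ * Real.cos θ, R₁ * Real.sin θ) = 0) :
    ∫ θ in -π..π, w (r₀ * Real.cos θ, r₀ * Real.sin θ) ^ 2 ≤
      π * (Real.log (π / δ) / T * ((1 + (r₀ * T) ^ 2) *
        ∫ r in R₁..r₀, ∫ θ in -π..π, gradSq w (r * Real.cos θ, r * Real.sin θ))) := by
  set σ : ℝ → ℝ := fun r => δ + T * (r - R₁) with hσ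
  have hσpos : ∀ r ∈ Icc R₁ r₀, 0 < σ r := fun r hr => by
    have := mul_nonneg hT.le (sub_nonneg.2 hr.1)
    simp only [hσ]; linarith
  have hσc : Continuous σ := by fun_prop
  have hσle : ∀ r ∈ Icc R₁ r₀, σ r ≤ π := fun r hr => by
    rw [← hTe]
    have : r ≤ r₀ := hr.2
    simp only [hσ]; gcongr
  have hg : Continuous (gradSq w) := continuous_gradSq hw
  have hdw := hw.continuous_fderiv (by simp)
  have hwc := hw.continuous
  set K := 1 + (r₀ * T) ^ 2 with hK
  set A := Real.log (π / δ) / T with hA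
  have hAe : ∫ r in R₁..r₀, (σ r)⁻¹ = A := by
    rw [hA, ← hTe]; exact integral_inv_affine hr₀.le hδ hT
  have hA0 : 0 ≤ A := by
    rw [← hAe]
    exact intervalIntegral.integral_nonneg hr₀.le fun r hr => (inv_pos.2 (hσpos r hr)).le
  have hcurve : ∀ t ∈ Icc (-1 : ℝ) 1,
      w (r₀ * Real.cos (π * t + π / 2), r₀ * Real.sin (π * t + π / 2)) ^ 2 ≤
      A * (K * ∫ r in R₁..r₀, σ r *
        gradSq w (r * Real.cos (σ r * t + π / 2), r * Real.sin (σ r * t + π / 2))) := by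
    intro t ht
    set D : ℝ → ℝ := fun r =>
      (Real.cos (σ r * t + π / 2) - r * (T * t) * Real.sin (σ r * t + π / 2)) *
          fderiv ℝ w (r * Real.cos (σ r * t + π / 2), r * Real.sin (σ r * t + π / 2)) (1, 0) +
        (Real.sin (σ r * t + π / 2) + r * (T * t) * Real.cos (σ r * t + π / 2)) *
          fderiv ℝ w (r * Real.cos (σ r * t + π / 2), r * Real.sin (σ r * t + π / 2)) (0, 1) with hD
    have hDc : Continuous D := by
      simp only [hD]
      fun_prop
    have hder : ∀ r, HasDerivAt (fun r => w (r * Real.cos (σ r * t + π / 2),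
        r * Real.sin (σ r * t + π / 2))) (D r) r := fun r => by
      have hθ : HasDerivAt (fun r => σ r * t + π / 2) (T * t) r := by
        have h1 : HasDerivAt σ T r := by
          simpa [hσ] using (((hasDerivAt_id r).sub_const R₁).const_mul T).const_add δ
        exact (h1.mul_const t).add_const _
      exact hasDerivAt_polar_curve (hw.differentiable (by simp)) hθ
    have hftc := intervalIntegral.integral_eq_sub_of_hasDerivAt (a := R₁) (b := r₀)
      (fun r _ => hder r) (hDc.intervalIntegrable _ _)
    have hzero : w (R₁ * Real.cos (σ R₁ * t + π / 2), R₁ * Real.sin (σ R₁ * t + π / 2)) = 0 := by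
      refine hz _ ?_
      have : σ R₁ = δ := by simp [hσ]
      rw [this]
      constructor <;> nlinarith [ht.1, ht.2]
    have hσr₀ : σ r₀ = π := hTe
    rw [hzero, sub_zero, hσr₀] at hftc
    rw [← hftc]
    refine (sq_intervalIntegral_le hr₀.le hDc hσc hσpos).trans ?_
    rw [hAe]
    refine mul_le_mul_of_nonneg_left ?_ hA0
    rw [← intervalIntegral.integral_const_mul]
    refine intervalIntegral.integral_mono_on hr₀.le
      ((hσc.mul (hDc.pow 2)).intervalIntegrable _ _)
      (Continuous.intervalIntegrable (by fun_prop) _ _) fun r hr => ?_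
    have h1 := sq_polar_curve_deriv_le
      (fderiv ℝ w (r * Real.cos (σ r * t + π / 2), r * Real.sin (σ r * t + π / 2)) (1, 0))
      (fderiv ℝ w (r * Real.cos (σ r * t + π / 2), r * Real.sin (σ r * t + π / 2)) (0, 1))
      (r * (T * t)) (σ r * t + π / 2)
    have h2 : 1 + (r * (T * t)) ^ 2 ≤ K := by
      have ht2 : t ^ 2 ≤ 1 := by nlinarith [ht.1, ht.2]
      have hr2 : r ^ 2 ≤ r₀ ^ 2 := by
        have := hr.1
        exact pow_le_pow_left₀ (by linarith) hr.2 2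
      have : (r * (T * t)) ^ 2 = (r ^ 2 * T ^ 2) * t ^ 2 := by ring
      rw [this, hK, mul_pow]
      have h3 : r ^ 2 * T ^ 2 * t ^ 2 ≤ r ^ 2 * T ^ 2 * 1 := by gcongr
      have h4 : r ^ 2 * T ^ 2 ≤ r₀ ^ 2 * T ^ 2 := by gcongr
      linarith
    have h3 : D r ^ 2 ≤
        K * gradSq w (r * Real.cos (σ r * t + π / 2), r * Real.sin (σ r * t + π / 2)) :=
      h1.trans (mul_le_mul_of_nonneg_right h2 (gradSq_nonneg w _))
    nlinarith [hσpos r hr]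
  have hswap : ∫ t in (-1 : ℝ)..1, ∫ r in R₁..r₀, σ r *
        gradSq w (r * Real.cos (σ r * t + π / 2), r * Real.sin (σ r * t + π / 2)) ≤
      ∫ r in R₁..r₀, ∫ θ in -π..π, gradSq w (r * Real.cos θ, r * Real.sin θ) := by
    rw [intervalIntegral_swap_of_continuous (by fun_prop)]
    · refine intervalIntegral.integral_mono_on hr₀.le
        (Continuous.intervalIntegrable
          (intervalIntegral.continuous_parametric_intervalIntegral_of_continuous'
            (by fun_prop) _ _) _ _)
        (Continuous.intervalIntegrable
          (intervalIntegral.continuous_parametric_intervalIntegral_of_continuous'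
            (by fun_prop) _ _) _ _) fun r hr => ?_
      rw [intervalIntegral.integral_const_mul, ← smul_eq_mul,
        intervalIntegral.smul_integral_comp_mul_add
          (fun θ => gradSq w (r * Real.cos θ, r * Real.sin θ)), ← integral_polar_shift]
      have := hσle r hr
      have := hσpos r hr
      exact intervalIntegral.integral_mono_interval (by linarith) (by linarith) (by linarith)
        (.of_forall fun θ => gradSq_nonneg w _) (Continuous.intervalIntegrable (by fun_prop) _ _)
  have hL : ∫ θ in -π..π, w (r₀ * Real.cos θ, r₀ * Real.sin θ) ^ 2 =
      π * ∫ t in (-1 : ℝ)..1,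
        w (r₀ * Real.cos (π * t + π / 2), r₀ * Real.sin (π * t + π / 2)) ^ 2 := by
    rw [← integral_polar_shift (fun x => w x ^ 2), ← smul_eq_mul,
      intervalIntegral.smul_integral_comp_mul_add
        (fun θ => w (r₀ * Real.cos θ, r₀ * Real.sin θ) ^ 2)]
    congr 1 <;> ring
  rw [hL]
  refine mul_le_mul_of_nonneg_left ?_ Real.pi_pos.le
  have hIc : Continuous fun t => A * (K * ∫ r in R₁..r₀, σ r *
        gradSq w (r * Real.cos (σ r * t + π / 2), r * Real.sin (σ r * t + π / 2))) :=
    continuous_const.mul (continuous_const.mul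
      (intervalIntegral.continuous_parametric_intervalIntegral_of_continuous'
        (by fun_prop) _ _))
  refine (intervalIntegral.integral_mono_on (by norm_num)
    (Continuous.intervalIntegrable (by fun_prop) _ _)
    (hIc.intervalIntegrable _ _) hcurve).trans ?_
  rw [intervalIntegral.integral_const_mul, intervalIntegral.integral_const_mul]
  gcongr

lemma integral_le_of_hasDerivAt_add {a b : ℝ} (hab : a ≤ b) {Ψ Ψ' g h : ℝ → ℝ}
    (hΨ : ∀ r, HasDerivAt Ψ (Ψ' r) r) (hΨ' : Continuous Ψ') (hg : Continuous g)
    (hh : Continuous h) (hle : ∀ r ∈ Icc a b, g r ≤ Ψ' r + h r) :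
    ∫ r in a..b, g r ≤ Ψ b - Ψ a + ∫ r in a..b, h r := by
  rw [← intervalIntegral.integral_eq_sub_of_hasDerivAt (fun r _ => hΨ r)
    (hΨ'.intervalIntegrable _ _), ← intervalIntegral.integral_add (hΨ'.intervalIntegrable _ _)
    (hh.intervalIntegrable _ _)]
  exact intervalIntegral.integral_mono_on hab (hg.intervalIntegrable _ _)
    ((hΨ'.add hh).intervalIntegrable _ _) hle

/-- A weighted Hardy-type inequality on `[0, R]` with the weight `r (R² - r²)²`. -/
lemma integral_weight_sq_le {r₀ R : ℝ} (hr₀ : 0 < r₀) (hR : r₀ < R) :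
    ∃ C, 0 < C ∧ ∀ f f' : ℝ → ℝ, (∀ r, HasDerivAt f (f' r) r) → Continuous f' →
      ∫ r in 0..R, r * ((R ^ 2 - r ^ 2) ^ 2 * f r ^ 2) ≤
        C * (f r₀ ^ 2 + ∫ r in 0..R, r * ((R ^ 2 - r ^ 2) ^ 2 * f' r ^ 2)) := by
  set ρ₀ := R ^ 2 - r₀ ^ 2 with hρ₀
  have hρ : 0 < ρ₀ := by rw [hρ₀]; nlinarith
  set C₁ := R ^ 4 * r₀ ^ 2 + ρ₀ ^ 3
  set C₂ := R ^ 4 * r₀ ^ 2 / ρ₀ ^ 2 with hC₂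
  set C₃ := R ^ 4 / r₀ ^ 2 with hC₃
  have hRpos : 0 < R := hr₀.trans hR
  have h1 : 0 < C₁ := by positivity
  have h2 : 0 < C₂ := by positivity
  have h3 : 0 < C₃ := by positivity
  refine ⟨C₁ + C₂ + C₃, by positivity, fun f f' hf hf' => ?_⟩
  have hfc : Continuous f := continuous_iff_continuousAt.2 fun r => (hf r).continuousAt
  set g : ℝ → ℝ := fun r => r * ((R ^ 2 - r ^ 2) ^ 2 * f r ^ 2) with hg
  set h : ℝ → ℝ := fun r => r * ((R ^ 2 - r ^ 2) ^ 2 * f' r ^ 2) with hh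
  have hgc : Continuous g := by fun_prop
  have hhc : Continuous h := by fun_prop
  have inner := integral_le_of_hasDerivAt_add (g := g) (h := fun r => C₂ * h r) hr₀.le
    (Ψ := fun r => R ^ 4 * (r ^ 2 * f r ^ 2))
    (Ψ' := fun r => R ^ 4 * (2 * r * f r ^ 2 + r ^ 2 * (2 * f r * f' r)))
    (fun r => by
      refine ((((hasDerivAt_id r).pow 2).mul ((hf r).pow 2)).const_mul (R ^ 4)).congr_deriv ?_
      simp)
    (by fun_prop) hgc (by fun_prop) fun r hr => by
      have hr0 := hr.1
      have hr1 : r ^ 2 ≤ r₀ ^ 2 := pow_le_pow_left₀ hr0 hr.2 2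
      have a1 : (R ^ 2 - r ^ 2) ^ 2 ≤ R ^ 4 := by
        have : R ^ 4 = (R ^ 2) ^ 2 := by ring
        rw [this]
        exact pow_le_pow_left₀ (by nlinarith) (by nlinarith [sq_nonneg r]) 2
      have a2 : ρ₀ ^ 2 ≤ (R ^ 2 - r ^ 2) ^ 2 := pow_le_pow_left₀ hρ.le (by linarith) 2
      have b1 : g r ≤ R ^ 4 * (r * f r ^ 2) := by
        have : 0 ≤ r * f r ^ 2 := by positivity
        calc g r = (R ^ 2 - r ^ 2) ^ 2 * (r * f r ^ 2) := by simp only [hg]; ring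
          _ ≤ _ := by gcongr
      have b2 : R ^ 4 * (r ^ 3 * f' r ^ 2) ≤ C₂ * h r := by
        have : C₂ * h r = R ^ 4 * (r * f' r ^ 2 * (r₀ ^ 2 * ((R ^ 2 - r ^ 2) ^ 2 / ρ₀ ^ 2))) := by
          simp only [hC₂, hh]; ring
        rw [this]
        have h4 : 1 ≤ (R ^ 2 - r ^ 2) ^ 2 / ρ₀ ^ 2 := (one_le_div (by positivity)).2 a2
        have h5 : r ^ 2 * 1 ≤ r₀ ^ 2 * ((R ^ 2 - r ^ 2) ^ 2 / ρ₀ ^ 2) := by gcongr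
        have : r ^ 3 * f' r ^ 2 = r * f' r ^ 2 * (r ^ 2 * 1) := by ring
        rw [this]
        gcongr
      have b3 : 0 ≤ R ^ 4 * (r * (f r + r * f' r) ^ 2) := by positivity
      have : R ^ 4 * (2 * r * f r ^ 2 + r ^ 2 * (2 * f r * f' r)) + R ^ 4 * (r ^ 3 * f' r ^ 2) =
        R ^ 4 * (r * f r ^ 2) + R ^ 4 * (r * (f r + r * f' r) ^ 2) := by ring
      linarith
  have outer := integral_le_of_hasDerivAt_add (g := g) (h := fun r => C₃ * h r) hR.le
    (Ψ := fun r => -((R ^ 2 - r ^ 2) ^ 3 * f r ^ 2))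
    (Ψ' := fun r => 6 * r * (R ^ 2 - r ^ 2) ^ 2 * f r ^ 2 -
      (R ^ 2 - r ^ 2) ^ 3 * (2 * f r * f' r))
    (fun r => by
      refine ((((((hasDerivAt_id r).pow 2).const_sub (R ^ 2)).pow 3).mul
        ((hf r).pow 2)).neg).congr_deriv ?_
      simp
      ring)
    (by fun_prop) hgc (by fun_prop) fun r hr => by
      have hr0 : 0 < r := hr₀.trans_le hr.1
      have a1 : r ^ 2 ≤ R ^ 2 := pow_le_pow_left₀ hr0.le hr.2 2
      have a2 : (R ^ 2 - r ^ 2) ^ 2 ≤ R ^ 4 := by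
        have : R ^ 4 = (R ^ 2) ^ 2 := by ring
        rw [this]
        exact pow_le_pow_left₀ (by linarith) (by nlinarith [sq_nonneg r]) 2
      have a3 : (R ^ 2 - r ^ 2) ^ 2 ≤ C₃ * r ^ 2 := by
        have : r₀ ^ 2 ≤ r ^ 2 := pow_le_pow_left₀ hr₀.le hr.1 2
        calc (R ^ 2 - r ^ 2) ^ 2 ≤ R ^ 4 := a2
          _ = C₃ * r₀ ^ 2 := by rw [hC₃]; field_simp
          _ ≤ _ := by gcongr
      set ρ := R ^ 2 - r ^ 2
      have key : 0 ≤ 5 * r * f r ^ 2 - 2 * ρ * f r * f' r + C₃ * r * f' r ^ 2 := by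
        refine nonneg_of_mul_nonneg_right (a := r) ?_ hr0
        have : r * (5 * r * f r ^ 2 - 2 * ρ * f r * f' r + C₃ * r * f' r ^ 2) =
          4 * (r * f r) ^ 2 + (r * f r - ρ * f' r) ^ 2 + (C₃ * r ^ 2 - ρ ^ 2) * f' r ^ 2 := by ring
        rw [this]
        have := mul_nonneg (sub_nonneg.2 a3) (sq_nonneg (f' r))
        positivity
      have : 0 ≤ ρ ^ 2 * (5 * r * f r ^ 2 - 2 * ρ * f r * f' r + C₃ * r * f' r ^ 2) := by
        positivity
      simp only [hg, hh]
      nlinarith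
  rw [intervalIntegral.integral_const_mul] at inner outer
  have hg' := fun a b => hgc.intervalIntegrable (μ := volume) a b
  have hh' := fun a b => hhc.intervalIntegrable (μ := volume) a b
  rw [← intervalIntegral.integral_add_adjacent_intervals (hg' 0 r₀) (hg' r₀ R),
    ← intervalIntegral.integral_add_adjacent_intervals (hh' 0 r₀) (hh' r₀ R)]
  have p1 : 0 ≤ ∫ r in 0..r₀, h r := intervalIntegral.integral_nonneg hr₀.le fun r hr => by
    have := hr.1
    simp only [hh]; positivity
  have p2 : 0 ≤ ∫ r in r₀..R, h r := intervalIntegral.integral_nonneg hR.le fun r hr => by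
    have := hr₀.le.trans hr.1
    simp only [hh]; positivity
  have p3 := sq_nonneg (f r₀)
  have q1 := mul_nonneg h1.le p1
  have q2 := mul_nonneg h1.le p2
  have q3 := mul_nonneg h2.le p2
  have q4 := mul_nonneg h3.le p1
  have q5 := mul_nonneg h2.le p3
  have q6 := mul_nonneg h3.le p3
  have e : (C₁ + C₂ + C₃) * (f r₀ ^ 2 + ((∫ r in 0..r₀, h r) + ∫ r in r₀..R, h r)) =
    C₁ * f r₀ ^ 2 + C₂ * (∫ r in 0..r₀, h r) + C₃ * (∫ r in r₀..R, h r) +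
    (C₁ * (∫ r in 0..r₀, h r) + C₁ * (∫ r in r₀..R, h r) + C₂ * (∫ r in r₀..R, h r) +
      C₃ * (∫ r in 0..r₀, h r) + C₂ * f r₀ ^ 2 + C₃ * f r₀ ^ 2) := by ring
  rw [e]
  have e1 : C₁ * f r₀ ^ 2 = R ^ 4 * (r₀ ^ 2 * f r₀ ^ 2) + ρ₀ ^ 3 * f r₀ ^ 2 := by ring
  simp only [sub_self, ← hρ₀] at inner outer
  ring_nf at inner outer e1 ⊢
  linarith

lemma abs_log_ge_of_lt_half {δ : ℝ} (hδ : 0 < δ) (hδ' : δ < 1 / 2) :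
    Real.log 2 ≤ |Real.log δ| := by
  rw [abs_of_neg (Real.log_neg hδ (by linarith)), ← Real.log_inv]
  exact Real.log_le_log (by norm_num) (by rw [le_inv_comm₀ (by norm_num) hδ]; linarith)

lemma log_pi_div_le {δ : ℝ} (hδ : 0 < δ) (hδ' : δ < 1 / 2) :
    Real.log (π / δ) ≤ 3 * |Real.log δ| := by
  have h := abs_log_ge_of_lt_half hδ hδ'
  have h2 : Real.log π ≤ 2 * Real.log 2 := by
    rw [← Real.log_rpow (by norm_num)]
    exact Real.log_le_log Real.pi_pos (by norm_num; exact Real.pi_le_four)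
  rw [Real.log_div Real.pi_pos.ne' hδ.ne']
  rw [abs_of_neg (Real.log_neg hδ (by linarith))] at h ⊢
  linarith

/-- Poincaré inequality with weight `(R₂² - |x|²)²` for functions vanishing on the cracks. -/
lemma weighted_poincare {R₁ R₂ : ℝ} (hR₁ : 0 < R₁) (hR₁₂ : R₁ < R₂) :
    ∃ C, 0 < C ∧ ∀ δ, 0 < δ → δ < 1 / 2 → ∀ w, testFun (disk R₂ \ crackSet R₁ δ) w →
      ∫ x, (R₂ ^ 2 - (x.1 ^ 2 + x.2 ^ 2)) ^ 2 * w x ^ 2 ≤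
        C * |Real.log δ| * ∫ x, (R₂ ^ 2 - (x.1 ^ 2 + x.2 ^ 2)) ^ 2 * gradSq w x := by
  set r₀ := (R₁ + R₂) / 2 with hr₀
  have hr₁ : R₁ < r₀ := by rw [hr₀]; linarith
  have hr₂ : r₀ < R₂ := by rw [hr₀]; linarith
  have hR₂ : 0 < R₂ := hR₁.trans hR₁₂
  have hr0 : 0 < r₀ := hR₁.trans hr₁
  have hρ : 0 < R₂ ^ 2 - r₀ ^ 2 := by nlinarith
  have hb : 0 < r₀ - R₁ := sub_pos.2 hr₁
  obtain ⟨C₁, hC₁, hrad⟩ := integral_weight_sq_le hr0 hr₂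
  set K := π * (3 * (r₀ - R₁) * ((1 + (r₀ * (π / (r₀ - R₁))) ^ 2) *
    (1 / (R₁ * (R₂ ^ 2 - r₀ ^ 2) ^ 2)))) with hK
  have hpi := Real.pi_pos
  have hK0 : 0 < K := by positivity
  have hl2 : 0 < Real.log 2 := Real.log_pos (by norm_num)
  refine ⟨C₁ * (K + 1 / Real.log 2), by positivity, fun δ hδ hδ' w hw => ?_⟩
  have hwc := hw.1.continuous
  have hdw := hw.1.continuous_fderiv (by simp)
  have hgc := continuous_gradSq hw.1
  have hout : ∀ x : ℝ × ℝ, R₂ ^ 2 ≤ x.1 ^ 2 + x.2 ^ 2 → x ∉ tsupport w := fun x hx h =>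
    not_lt.2 hx (hw.2.2 h).1
  have hpol : ∀ f : ℝ × ℝ → ℝ, Continuous f → (∀ x, x ∉ tsupport w → f x = 0) →
      ∫ x, (R₂ ^ 2 - (x.1 ^ 2 + x.2 ^ 2)) ^ 2 * f x = ∫ r in 0..R₂, ∫ θ in -π..π,
        r * ((R₂ ^ 2 - r ^ 2) ^ 2 * f (r * Real.cos θ, r * Real.sin θ)) := by
    intro f hf hf0
    rw [integral_eq_polar (by fun_prop) hR₂ fun x hx => by rw [hf0 x (hout x hx), mul_zero]]
    have e : ∀ r θ : ℝ, (r * Real.cos θ) ^ 2 + (r * Real.sin θ) ^ 2 = r ^ 2 := fun r θ => by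
      rw [mul_pow, mul_pow, ← mul_add, Real.cos_sq_add_sin_sq, mul_one]
    simp only [e]
  rw [hpol (fun x => w x ^ 2) (by fun_prop)
      (fun x hx => by rw [image_eq_zero_of_notMem_tsupport hx]; norm_num),
    hpol (gradSq w) hgc fun x hx => by
      have := image_eq_zero_of_notMem_tsupport (f := fderiv ℝ w)
        (fun h => hx (tsupport_fderiv_subset ℝ h))
      simp [gradSq, this]]
  set E := ∫ r in 0..R₂, ∫ θ in -π..π,
    r * ((R₂ ^ 2 - r ^ 2) ^ 2 * gradSq w (r * Real.cos θ, r * Real.sin θ)) with hE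
  have hpp : -π ≤ π := by linarith
  have hEcont : Continuous fun r => ∫ θ in -π..π,
      r * ((R₂ ^ 2 - r ^ 2) ^ 2 * gradSq w (r * Real.cos θ, r * Real.sin θ)) :=
    intervalIntegral.continuous_parametric_intervalIntegral_of_continuous' (by fun_prop) _ _
  have hEnn : ∀ r, 0 ≤ r → 0 ≤ ∫ θ in -π..π,
      r * ((R₂ ^ 2 - r ^ 2) ^ 2 * gradSq w (r * Real.cos θ, r * Real.sin θ)) := fun r hr =>
    intervalIntegral.integral_nonneg hpp fun θ _ =>
      mul_nonneg hr (mul_nonneg (sq_nonneg _) (gradSq_nonneg w _))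
  have hE0 : 0 ≤ E := intervalIntegral.integral_nonneg hR₂.le fun r hr => hEnn r hr.1
  have hlog := abs_log_ge_of_lt_half hδ hδ'
  have hring : ∫ r in R₁..r₀, ∫ θ in -π..π, gradSq w (r * Real.cos θ, r * Real.sin θ) ≤
      1 / (R₁ * (R₂ ^ 2 - r₀ ^ 2) ^ 2) * E := by
    have h1 : ∫ r in R₁..r₀, ∫ θ in -π..π, gradSq w (r * Real.cos θ, r * Real.sin θ) ≤
        ∫ r in R₁..r₀, 1 / (R₁ * (R₂ ^ 2 - r₀ ^ 2) ^ 2) * ∫ θ in -π..π,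
          r * ((R₂ ^ 2 - r ^ 2) ^ 2 * gradSq w (r * Real.cos θ, r * Real.sin θ)) := by
      refine intervalIntegral.integral_mono_on hr₁.le
        (Continuous.intervalIntegrable
          (intervalIntegral.continuous_parametric_intervalIntegral_of_continuous'
            (by fun_prop) _ _) _ _)
        ((hEcont.const_mul _).intervalIntegrable _ _) fun r hr => ?_
      rw [← intervalIntegral.integral_const_mul]
      refine intervalIntegral.integral_mono_on hpp
        (Continuous.intervalIntegrable (by fun_prop) _ _)
        (Continuous.intervalIntegrable (by fun_prop) _ _) fun θ _ => ?_
      have hrr : 0 < r := hR₁.trans_le hr.1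
      have h2 : (R₂ ^ 2 - r₀ ^ 2) ^ 2 ≤ (R₂ ^ 2 - r ^ 2) ^ 2 :=
        pow_le_pow_left₀ hρ.le (by nlinarith [hr.2]) 2
      have h3 : R₁ * (R₂ ^ 2 - r₀ ^ 2) ^ 2 ≤ r * (R₂ ^ 2 - r ^ 2) ^ 2 := by
        have := hr.1
        gcongr
      rw [one_div_mul_eq_div, le_div_iff₀ (by positivity)]
      have := mul_le_mul_of_nonneg_left h3 (gradSq_nonneg w (r * Real.cos θ, r * Real.sin θ))
      linarith
    rw [intervalIntegral.integral_const_mul] at h1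
    refine h1.trans (mul_le_mul_of_nonneg_left ?_ (by positivity))
    refine intervalIntegral.integral_mono_interval hR₁.le hr₁.le hr₂.le ?_
      (hEcont.intervalIntegrable _ _)
    refine (ae_restrict_iff' measurableSet_Ioc).2 (.of_forall fun r hr => hEnn r hr.1.le)
  have hcirc : ∫ θ in -π..π, w (r₀ * Real.cos θ, r₀ * Real.sin θ) ^ 2 ≤ K * |Real.log δ| * E := by
    set T := (π - δ) / (r₀ - R₁) with hTdef
    have hpi3 := Real.pi_gt_three
    have hT0 : 1 / (r₀ - R₁) ≤ T := by rw [hTdef]; gcongr; linarith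
    have hT1 : T ≤ π / (r₀ - R₁) := by rw [hTdef]; gcongr; linarith
    have hTpos : 0 < T := lt_of_lt_of_le (by positivity) hT0
    refine (integral_sq_circle_le hw.1 hR₁ hr₁ hδ hTpos (by rw [hTdef]; field_simp; ring)
      fun θ hθ => ?_).trans ?_
    · exact image_eq_zero_of_notMem_tsupport fun h => (hw.2.2 h).2 ⟨θ, Or.inl hθ, rfl⟩
    · have h1 : Real.log (π / δ) / T ≤ 3 * |Real.log δ| * (r₀ - R₁) := by
        rw [div_le_iff₀ hTpos]
        have h2 : 1 ≤ (r₀ - R₁) * T := by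
          rwa [div_le_iff₀' hb] at hT0
        calc Real.log (π / δ) ≤ 3 * |Real.log δ| * 1 := by
              rw [mul_one]; exact log_pi_div_le hδ hδ'
          _ ≤ 3 * |Real.log δ| * ((r₀ - R₁) * T) := by gcongr
          _ = _ := by ring
      have h0 : 0 ≤ ∫ r in R₁..r₀, ∫ θ in -π..π, gradSq w (r * Real.cos θ, r * Real.sin θ) :=
        intervalIntegral.integral_nonneg hr₁.le fun r _ =>
          intervalIntegral.integral_nonneg hpp fun θ _ => gradSq_nonneg w _
      calc _ ≤ π * (3 * |Real.log δ| * (r₀ - R₁) * ((1 + (r₀ * (π / (r₀ - R₁))) ^ 2) *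
            (1 / (R₁ * (R₂ ^ 2 - r₀ ^ 2) ^ 2) * E))) := by gcongr
        _ = _ := by rw [hK]; ring
  rw [intervalIntegral_swap_of_continuous (by fun_prop)]
  have hEswap : E = ∫ θ in -π..π, ∫ r in 0..R₂,
      r * ((R₂ ^ 2 - r ^ 2) ^ 2 * gradSq w (r * Real.cos θ, r * Real.sin θ)) := by
    rw [hE, intervalIntegral_swap_of_continuous (by fun_prop)]
  have hIθ : Continuous fun θ => ∫ r in 0..R₂,
      r * ((R₂ ^ 2 - r ^ 2) ^ 2 * gradSq w (r * Real.cos θ, r * Real.sin θ)) :=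
    intervalIntegral.continuous_parametric_intervalIntegral_of_continuous' (by fun_prop) _ _
  have hcw : Continuous fun θ => w (r₀ * Real.cos θ, r₀ * Real.sin θ) ^ 2 := by fun_prop
  have hmain : ∫ θ in -π..π, ∫ r in 0..R₂,
      r * ((R₂ ^ 2 - r ^ 2) ^ 2 * w (r * Real.cos θ, r * Real.sin θ) ^ 2) ≤
      ∫ θ in -π..π, C₁ * (w (r₀ * Real.cos θ, r₀ * Real.sin θ) ^ 2 + ∫ r in 0..R₂,
        r * ((R₂ ^ 2 - r ^ 2) ^ 2 * gradSq w (r * Real.cos θ, r * Real.sin θ))) := by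
    refine intervalIntegral.integral_mono_on hpp
      (Continuous.intervalIntegrable
        (intervalIntegral.continuous_parametric_intervalIntegral_of_continuous'
          (by fun_prop) _ _) _ _)
      (((hcw.add hIθ).const_mul C₁).intervalIntegrable _ _) fun θ _ => ?_
    set f' : ℝ → ℝ := fun r =>
      (Real.cos θ - r * 0 * Real.sin θ) *
          fderiv ℝ w (r * Real.cos θ, r * Real.sin θ) (1, 0) +
        (Real.sin θ + r * 0 * Real.cos θ) *
          fderiv ℝ w (r * Real.cos θ, r * Real.sin θ) (0, 1) with hf'
    have hf'c : Continuous f' := by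
      simp only [hf']
      fun_prop
    refine (hrad (fun r => w (r * Real.cos θ, r * Real.sin θ)) f' (fun r =>
      hasDerivAt_polar_curve (hw.1.differentiable (by simp)) (hasDerivAt_const r θ)) hf'c).trans ?_
    refine mul_le_mul_of_nonneg_left (add_le_add_right ?_ _) hC₁.le
    refine intervalIntegral.integral_mono_on hR₂.le
      (Continuous.intervalIntegrable (by fun_prop) _ _)
      (Continuous.intervalIntegrable (by fun_prop) _ _) fun r hr => ?_
    have h1 : f' r ^ 2 ≤ gradSq w (r * Real.cos θ, r * Real.sin θ) := by
      have := sq_polar_curve_deriv_le (fderiv ℝ w (r * Real.cos θ, r * Real.sin θ) (1, 0))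
        (fderiv ℝ w (r * Real.cos θ, r * Real.sin θ) (0, 1)) (r * 0) θ
      refine this.trans (le_of_eq ?_)
      simp [gradSq]
    have := hr.1
    gcongr
  refine hmain.trans ?_
  rw [intervalIntegral.integral_const_mul, intervalIntegral.integral_add
    (hcw.intervalIntegrable _ _) (hIθ.intervalIntegrable _ _), ← hEswap, mul_assoc, mul_assoc]
  refine mul_le_mul_of_nonneg_left ?_ hC₁.le
  have : E ≤ 1 / Real.log 2 * (|Real.log δ| * E) := by
    rw [one_div_mul_eq_div, le_div_iff₀ hl2, mul_comm]
    gcongr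
  linarith

lemma groundState_bounds {t₀ m M R : ℝ} (ht₀ : 0 < t₀) (hR : 0 < R)
    (hb : ∀ s ∈ Icc 0 t₀, m * (t₀ - s) ≤ besselSeries 0 s ∧ besselSeries 0 s ≤ M * (t₀ - s))
    {x : ℝ × ℝ} (hx : x ∈ disk R) :
    m * (t₀ / R ^ 2) * (R ^ 2 - (x.1 ^ 2 + x.2 ^ 2)) ≤ groundState (t₀ / R ^ 2) x ∧
      groundState (t₀ / R ^ 2) x ≤ M * (t₀ / R ^ 2) * (R ^ 2 - (x.1 ^ 2 + x.2 ^ 2)) := by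
  have hx' : x.1 ^ 2 + x.2 ^ 2 < R ^ 2 := hx
  have hκ : 0 < t₀ / R ^ 2 := by positivity
  have e : t₀ / R ^ 2 * (R ^ 2 - (x.1 ^ 2 + x.2 ^ 2)) = t₀ - t₀ / R ^ 2 * (x.1 ^ 2 + x.2 ^ 2) := by
    field_simp
  have h := hb (t₀ / R ^ 2 * (x.1 ^ 2 + x.2 ^ 2)) ⟨by positivity, by
    have := mul_pos hκ (sub_pos.2 hx'); linarith⟩
  rw [mul_assoc, mul_assoc, e]
  exact h

lemma groundState_pos {t₀ m M R : ℝ} (ht₀ : 0 < t₀) (hm : 0 < m) (hR : 0 < R)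
    (hb : ∀ s ∈ Icc 0 t₀, m * (t₀ - s) ≤ besselSeries 0 s ∧ besselSeries 0 s ≤ M * (t₀ - s))
    {x : ℝ × ℝ} (hx : x ∈ disk R) : 0 < groundState (t₀ / R ^ 2) x := by
  have hx' : x.1 ^ 2 + x.2 ^ 2 < R ^ 2 := hx
  have := sub_pos.2 hx'
  exact (by positivity : 0 < m * (t₀ / R ^ 2) * (R ^ 2 - (x.1 ^ 2 + x.2 ^ 2))).trans_le
    (groundState_bounds ht₀ hR hb hx).1

/-- If a Poincaré inequality with weight `(R² - |x|²)²` holds on `ω ⊆ B_R` then the Rayleigh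
quotients on `ω` are bounded below by `4 κ` plus the inverse of the Poincaré constant. -/
lemma le_rayleigh_of_weighted_poincare {t₀ m M R A : ℝ} (ht₀ : 0 < t₀) (hm : 0 < m) (hM : 0 < M)
    (hR : 0 < R) (hA : 0 < A)
    (hb : ∀ s ∈ Icc 0 t₀, m * (t₀ - s) ≤ besselSeries 0 s ∧ besselSeries 0 s ≤ M * (t₀ - s))
    {ω : Set (ℝ × ℝ)} (hω : ω ⊆ disk R)
    (hP : ∀ w, testFun ω w → ∫ x, (R ^ 2 - (x.1 ^ 2 + x.2 ^ 2)) ^ 2 * w x ^ 2 ≤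
      A * ∫ x, (R ^ 2 - (x.1 ^ 2 + x.2 ^ 2)) ^ 2 * gradSq w x)
    {u : ℝ × ℝ → ℝ} (hu : testFun ω u) (h0 : u ≠ 0) :
    4 * (t₀ / R ^ 2) + m ^ 2 / (M ^ 2 * A) ≤ rayleigh ω u := by
  set κ := t₀ / R ^ 2 with hκdef
  have hκ : 0 < κ := by positivity
  obtain ⟨w, hw, huw⟩ := exists_eq_mul_of_testFun hu (contDiff_groundState κ)
    (fun x hx => (groundState_pos ht₀ hm hR hb (hω hx)).ne')
  have hφc := (contDiff_groundState κ).continuous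
  have hwc := hw.1.continuous
  have hgc := continuous_gradSq hw.1
  have hcw : ∀ {f g : ℝ × ℝ → ℝ}, HasCompactSupport g → HasCompactSupport (fun x => f x * g x) :=
    fun h => h.mul_left
  have hw2 : HasCompactSupport fun x => w x ^ 2 :=
    hw.2.1.comp_left (g := fun t : ℝ => t ^ 2) (by simp)
  have hg := hasCompactSupport_gradSq hw.2.1
  have i1 : Integrable fun x => groundState κ x ^ 2 * w x ^ 2 :=
    Continuous.integrable_of_hasCompactSupport (by fun_prop) (hcw hw2)
  have i2 : Integrable fun x : ℝ × ℝ => (R ^ 2 - (x.1 ^ 2 + x.2 ^ 2)) ^ 2 * w x ^ 2 :=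
    Continuous.integrable_of_hasCompactSupport (by fun_prop) (hcw hw2)
  have i3 : Integrable fun x => groundState κ x ^ 2 * gradSq w x :=
    Continuous.integrable_of_hasCompactSupport (by fun_prop) (hcw hg)
  have i4 : Integrable fun x : ℝ × ℝ => (R ^ 2 - (x.1 ^ 2 + x.2 ^ 2)) ^ 2 * gradSq w x :=
    Continuous.integrable_of_hasCompactSupport (by fun_prop) (hcw hg)
  have hw0 : ∀ x ∉ disk R, w x = 0 := fun x hx =>
    image_eq_zero_of_notMem_tsupport fun h => hx (hω (hw.2.2 h))
  have hg0 : ∀ x ∉ disk R, gradSq w x = 0 := fun x hx => by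
    have := image_eq_zero_of_notMem_tsupport (f := fderiv ℝ w)
      (fun h => hx (hω (hw.2.2 (tsupport_fderiv_subset ℝ h))))
    simp [gradSq, this]
  have b1 : ∫ x, groundState κ x ^ 2 * w x ^ 2 ≤
      (M * κ) ^ 2 * ∫ x, (R ^ 2 - (x.1 ^ 2 + x.2 ^ 2)) ^ 2 * w x ^ 2 := by
    rw [← integral_const_mul]
    refine integral_mono i1 (i2.const_mul _) fun x => ?_
    by_cases hx : x ∈ disk R
    · have h1 := (groundState_bounds ht₀ hR hb hx).2
      have h2 := pow_le_pow_left₀ (groundState_pos ht₀ hm hR hb hx).le h1 2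
      have h3 := mul_le_mul_of_nonneg_right h2 (sq_nonneg (w x))
      rw [mul_pow, mul_assoc] at h3
      exact h3
    · simp [hw0 x hx]
  have b2 : (m * κ) ^ 2 * ∫ x, (R ^ 2 - (x.1 ^ 2 + x.2 ^ 2)) ^ 2 * gradSq w x ≤
      ∫ x, groundState κ x ^ 2 * gradSq w x := by
    rw [← integral_const_mul]
    refine integral_mono (i4.const_mul _) i3 fun x => ?_
    by_cases hx : x ∈ disk R
    · have h1 := (groundState_bounds ht₀ hR hb hx).1
      have hx' : x.1 ^ 2 + x.2 ^ 2 < R ^ 2 := hx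
      have := sub_pos.2 hx'
      have h2 := pow_le_pow_left₀ (by positivity) h1 2
      have h3 := mul_le_mul_of_nonneg_right h2 (gradSq_nonneg w x)
      rw [mul_pow, mul_assoc] at h3
      exact h3
    · simp [hg0 x hx]
  have hpos := integral_sq_pos hu.1.continuous hu.2.1 h0
  have hid := integral_gradSq_groundState_mul κ hw.1 hw.2.1
  have e : ∫ x, groundState κ x ^ 2 * w x ^ 2 = ∫ x, u x ^ 2 := by
    rw [huw]; simp only [mul_pow]
  have e' : (∫ x, gradSq u x) = 4 * κ * (∫ x, u x ^ 2) + ∫ x, groundState κ x ^ 2 * gradSq w x := by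
    rw [huw]; exact hid
  rw [rayleigh_eq hu, le_div_iff₀ hpos, e', add_mul]
  gcongr
  have b3 := (b1.trans (mul_le_mul_of_nonneg_left (hP w hw) (sq_nonneg _)))
  rw [e] at b3
  rw [div_mul_eq_mul_div, div_le_iff₀ (by positivity)]
  have b4 := mul_le_mul_of_nonneg_left b2 (by positivity : 0 ≤ M ^ 2 * A)
  have b5 := mul_le_mul_of_nonneg_left b3 (by positivity : 0 ≤ m ^ 2)
  nlinarith

lemma integral_le_of_radial_bound {f : ℝ × ℝ → ℝ} (hf : Continuous f) {R : ℝ} (hR : 0 < R)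
    (h0 : ∀ x, R ^ 2 ≤ x.1 ^ 2 + x.2 ^ 2 → f x = 0) {H H' : ℝ → ℝ}
    (hH : ∀ s ∈ Icc 0 (R ^ 2), HasDerivAt H (H' s) s) (hH' : ContinuousOn H' (Icc 0 (R ^ 2)))
    (hle : ∀ x : ℝ × ℝ, x.1 ^ 2 + x.2 ^ 2 ≤ R ^ 2 → f x ≤ H' (x.1 ^ 2 + x.2 ^ 2)) :
    ∫ x, f x ≤ π * (H (R ^ 2) - H 0) := by
  have hmem : ∀ r ∈ Icc 0 R, r ^ 2 ∈ Icc 0 (R ^ 2) := fun r hr =>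
    ⟨sq_nonneg _, pow_le_pow_left₀ hr.1 hr.2 2⟩
  have hc : ContinuousOn (fun r : ℝ => r * H' (r ^ 2)) (Icc 0 R) :=
    continuousOn_id.mul (hH'.comp (by fun_prop) hmem)
  rw [integral_eq_polar hf hR h0]
  have hF : Continuous fun r : ℝ => ∫ θ in -π..π, r * f (r * cos θ, r * sin θ) :=
    intervalIntegral.continuous_parametric_intervalIntegral_of_continuous' (by fun_prop) _ _
  calc ∫ r in 0..R, ∫ θ in -π..π, r * f (r * cos θ, r * sin θ)
      ≤ ∫ r in 0..R, 2 * π * (r * H' (r ^ 2)) := by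
        refine intervalIntegral.integral_mono_on hR.le (hF.intervalIntegrable _ _)
          (ContinuousOn.intervalIntegrable
            (by rw [uIcc_of_le hR.le]; exact continuousOn_const.mul hc)) ?_
        intro r hr
        have : ∫ θ in -π..π, r * f (r * cos θ, r * sin θ) ≤ ∫ θ in -π..π, r * H' (r ^ 2) := by
          refine intervalIntegral.integral_mono_on (by linarith [pi_pos])
            (Continuous.intervalIntegrable (by fun_prop) _ _) (by simp) fun θ _ => ?_
          have e : (r * cos θ) ^ 2 + (r * sin θ) ^ 2 = r ^ 2 := by
            rw [mul_pow, mul_pow, ← mul_add, cos_sq_add_sin_sq, mul_one]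
          have := hle (r * cos θ, r * sin θ) (by
            simp only [e]; exact (hmem r hr).2)
          simp only [e] at this
          exact mul_le_mul_of_nonneg_left this hr.1
        refine this.trans_eq ?_
        rw [intervalIntegral.integral_const, smul_eq_mul]
        ring
    _ = π * (H (R ^ 2) - H 0) := by
        have hd : ∀ r ∈ uIcc 0 R,
            HasDerivAt (fun r => π * H (r ^ 2)) (2 * π * (r * H' (r ^ 2))) r := by
          intro r hr
          rw [uIcc_of_le hR.le] at hr
          have h1 : HasDerivAt (fun r : ℝ => r ^ 2) (2 * r) r := by simpa using hasDerivAt_pow 2 r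
          exact ((HasDerivAt.comp (h₂ := H) (h := fun r : ℝ => r ^ 2) r
            (hH _ (hmem r hr)) h1).const_mul π).congr_deriv (by ring)
        rw [intervalIntegral.integral_eq_sub_of_hasDerivAt hd
          (ContinuousOn.intervalIntegrable
            (by rw [uIcc_of_le hR.le]; exact continuousOn_const.mul hc))]
        simp
        ring

lemma gradSq_comp_sq {f : ℝ → ℝ} {f' : ℝ} {x : ℝ × ℝ}
    (hf : HasDerivAt f f' (x.1 ^ 2 + x.2 ^ 2)) :
    gradSq (fun y => f (y.1 ^ 2 + y.2 ^ 2)) x = 4 * (x.1 ^ 2 + x.2 ^ 2) * f' ^ 2 := by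
  have h := hasFDerivAt_comp_sq (κ := 1) (x := x) (f := f) (f' := f') (by simpa using hf)
  simp only [one_mul, mul_one] at h
  unfold gradSq
  rw [h.fderiv]
  simp
  ring

lemma gradSq_comp_sub (g : ℝ × ℝ → ℝ) (p x : ℝ × ℝ) :
    gradSq (fun y => g (y - p)) x = gradSq g (x - p) := by
  unfold gradSq
  rw [fderiv_comp_sub]

lemma exists_bound_deriv_smoothTransition : ∃ B, 0 < B ∧
    (∀ x, (deriv Real.smoothTransition x) ^ 2 ≤ B) ∧
    ∀ x ∉ Icc (0 : ℝ) 1, deriv Real.smoothTransition x = 0 := by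
  have h0 : ∀ x ∉ Icc (0 : ℝ) 1, deriv Real.smoothTransition x = 0 := by
    intro x hx
    rw [mem_Icc, not_and_or, not_le, not_le] at hx
    rcases hx with hx | hx
    · have : Real.smoothTransition =ᶠ[nhds x] fun _ => 0 := by
        filter_upwards [Iio_mem_nhds hx] with y hy
        exact Real.smoothTransition.zero_of_nonpos (le_of_lt hy)
      rw [this.deriv_eq, deriv_const]
    · have : Real.smoothTransition =ᶠ[nhds x] fun _ => 1 := by
        filter_upwards [Ioi_mem_nhds hx] with y hy
        exact Real.smoothTransition.one_of_one_le (le_of_lt hy)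
      rw [this.deriv_eq, deriv_const]
  have hc : Continuous (deriv Real.smoothTransition) :=
    (Real.smoothTransition.contDiff (n := 1)).continuous_deriv le_rfl
  obtain ⟨B, hB⟩ := (isCompact_Icc (a := (0 : ℝ)) (b := 1)).exists_bound_of_continuousOn
    (hc.pow 2).continuousOn
  refine ⟨max B 1, by positivity, fun x => ?_, h0⟩
  by_cases hx : x ∈ Icc (0 : ℝ) 1
  · exact (le_abs_self _).trans ((hB x hx).trans (le_max_left _ _))
  · simp [h0 x hx]

lemma hasDerivAt_smoothTransition (x : ℝ) :
    HasDerivAt Real.smoothTransition (deriv Real.smoothTransition x) x :=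
  ((Real.smoothTransition.contDiff (n := 1)).differentiable (by simp) x).hasDerivAt

/-- The cutoff near the boundary of `B_R`. -/
def boundaryCutoff (R ε : ℝ) (x : ℝ × ℝ) : ℝ :=
  Real.smoothTransition ((R ^ 2 - (x.1 ^ 2 + x.2 ^ 2)) / ε - 1)

/-- The logarithmic cutoff near the origin. -/
def logCutoff (K δ : ℝ) (x : ℝ × ℝ) : ℝ :=
  Real.smoothTransition (Real.log ((x.1 ^ 2 + x.2 ^ 2 + δ ^ 2) / (K * δ ^ 2)) / |Real.log δ|)

lemma contDiff_boundaryCutoff (R ε : ℝ) : ContDiff ℝ (⊤ : ℕ∞) (boundaryCutoff R ε) :=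
  Real.smoothTransition.contDiff.comp (by fun_prop)

lemma contDiff_logCutoff {K δ : ℝ} (hK : 0 < K) (hδ : 0 < δ) :
    ContDiff ℝ (⊤ : ℕ∞) (logCutoff K δ) := by
  refine Real.smoothTransition.contDiff.comp (ContDiff.div_const (ContDiff.log (by fun_prop) ?_) _)
  intro x
  positivity

lemma gradSq_boundaryCutoff (R : ℝ) {ε : ℝ} (hε : ε ≠ 0) (x : ℝ × ℝ) :
    gradSq (boundaryCutoff R ε) x = 4 * (x.1 ^ 2 + x.2 ^ 2) *
      deriv Real.smoothTransition ((R ^ 2 - (x.1 ^ 2 + x.2 ^ 2)) / ε - 1) ^ 2 / ε ^ 2 := by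
  have h1 : HasDerivAt (fun s : ℝ => (R ^ 2 - s) / ε - 1) (-1 / ε) (x.1 ^ 2 + x.2 ^ 2) :=
    (((hasDerivAt_id _).const_sub _).div_const _).sub_const _
  have h := gradSq_comp_sq (x := x) ((hasDerivAt_smoothTransition _).comp _ h1)
  refine h.trans ?_
  field_simp

lemma gradSq_logCutoff {K δ : ℝ} (hK : 0 < K) (hδ : 0 < δ) (hδ1 : δ < 1) (x : ℝ × ℝ) :
    gradSq (logCutoff K δ) x = 4 * (x.1 ^ 2 + x.2 ^ 2) *
      deriv Real.smoothTransition
        (Real.log ((x.1 ^ 2 + x.2 ^ 2 + δ ^ 2) / (K * δ ^ 2)) / |Real.log δ|) ^ 2 /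
      ((x.1 ^ 2 + x.2 ^ 2 + δ ^ 2) * |Real.log δ|) ^ 2 := by
  have hl : 0 < |Real.log δ| := abs_pos.2 (Real.log_neg hδ hδ1).ne
  have hs : 0 < x.1 ^ 2 + x.2 ^ 2 + δ ^ 2 := by positivity
  have h1 : HasDerivAt (fun s : ℝ => Real.log ((s + δ ^ 2) / (K * δ ^ 2)) / |Real.log δ|)
      (1 / ((x.1 ^ 2 + x.2 ^ 2 + δ ^ 2) * |Real.log δ|)) (x.1 ^ 2 + x.2 ^ 2) := by
    refine ((((((hasDerivAt_id _).add_const (δ ^ 2)).div_const (K * δ ^ 2)).log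
      ?_).div_const _)).congr_deriv ?_
    · simp only [id]; positivity
    · simp only [id]; field_simp
  have h := gradSq_comp_sq (x := x) ((hasDerivAt_smoothTransition _).comp _ h1)
  refine h.trans ?_
  field_simp

lemma sq_smoothTransition_le_one (t : ℝ) : Real.smoothTransition t ^ 2 ≤ 1 :=
  pow_le_one₀ (Real.smoothTransition.nonneg _) (Real.smoothTransition.le_one _)

lemma boundaryCutoff_eq_zero {R ε : ℝ} (hε : 0 < ε) {x : ℝ × ℝ}
    (hx : R ^ 2 - (x.1 ^ 2 + x.2 ^ 2) ≤ ε) : boundaryCutoff R ε x = 0 := by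
  refine Real.smoothTransition.zero_of_nonpos ?_
  rw [sub_nonpos, div_le_one hε]
  exact hx

lemma boundaryCutoff_eq_one {R ε : ℝ} (hε : 0 < ε) {x : ℝ × ℝ}
    (hx : 2 * ε ≤ R ^ 2 - (x.1 ^ 2 + x.2 ^ 2)) : boundaryCutoff R ε x = 1 := by
  refine Real.smoothTransition.one_of_one_le ?_
  rw [le_sub_iff_add_le, le_div_iff₀ hε]
  linarith

lemma logCutoff_eq_zero {K δ : ℝ} (hK : 0 < K) (hδ : 0 < δ) {x : ℝ × ℝ}
    (hx : x.1 ^ 2 + x.2 ^ 2 + δ ^ 2 ≤ K * δ ^ 2) : logCutoff K δ x = 0 := by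
  refine Real.smoothTransition.zero_of_nonpos (div_nonpos_of_nonpos_of_nonneg ?_ (abs_nonneg _))
  exact Real.log_nonpos (by positivity) ((div_le_one (by positivity)).2 hx)

lemma logCutoff_eq_one {K δ : ℝ} (hK : 0 < K) (hδ : 0 < δ) (hδ1 : δ < 1) {x : ℝ × ℝ}
    (hx : K * δ ≤ x.1 ^ 2 + x.2 ^ 2 + δ ^ 2) : logCutoff K δ x = 1 := by
  have hl := Real.log_neg hδ hδ1
  refine Real.smoothTransition.one_of_one_le ((one_le_div (abs_pos.2 hl.ne)).2 ?_)
  rw [abs_of_neg hl, ← Real.log_inv]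
  refine Real.log_le_log (by positivity) ?_
  rw [le_div_iff₀ (by positivity)]
  refine le_trans (le_of_eq ?_) hx
  field_simp

lemma gradSq_mul_mul_le {a b c : ℝ × ℝ → ℝ} {x : ℝ × ℝ} (ha : DifferentiableAt ℝ a x)
    (hb : DifferentiableAt ℝ b x) (hc : DifferentiableAt ℝ c x) (hb1 : b x ^ 2 ≤ 1)
    (hc1 : c x ^ 2 ≤ 1) :
    gradSq (fun y => a y * (b y * c y)) x ≤
      3 * (gradSq a x + a x ^ 2 * gradSq b x + a x ^ 2 * gradSq c x) := by
  have e : ∀ v, fderiv ℝ (fun y => a y * (b y * c y)) x v =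
      b x * c x * fderiv ℝ a x v + a x * c x * fderiv ℝ b x v + a x * b x * fderiv ℝ c x v := by
    intro v
    rw [(ha.hasFDerivAt.fun_mul (hb.hasFDerivAt.fun_mul hc.hasFDerivAt)).fderiv]
    simp
    ring
  have key : ∀ p q r : ℝ, (b x * c x * p + a x * c x * q + a x * b x * r) ^ 2 ≤
      3 * (p ^ 2 + a x ^ 2 * q ^ 2 + a x ^ 2 * r ^ 2) := by
    intro p q r
    have hbc : b x ^ 2 * c x ^ 2 ≤ 1 := mul_le_one₀ hb1 (sq_nonneg _) hc1
    have h1 : (b x * c x * p + a x * c x * q + a x * b x * r) ^ 2 ≤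
        3 * ((b x * c x * p) ^ 2 + (a x * c x * q) ^ 2 + (a x * b x * r) ^ 2) := by
      linarith [sq_nonneg (b x * c x * p - a x * c x * q),
        sq_nonneg (b x * c x * p - a x * b x * r), sq_nonneg (a x * c x * q - a x * b x * r)]
    have h2 : (b x * c x * p) ^ 2 ≤ p ^ 2 := by
      have := mul_le_mul_of_nonneg_right hbc (sq_nonneg p)
      linarith
    have h3 : (a x * c x * q) ^ 2 ≤ a x ^ 2 * q ^ 2 := by
      have := mul_le_mul_of_nonneg_right hc1 (by positivity : 0 ≤ a x ^ 2 * q ^ 2)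
      linarith
    have h4 : (a x * b x * r) ^ 2 ≤ a x ^ 2 * r ^ 2 := by
      have := mul_le_mul_of_nonneg_right hb1 (by positivity : 0 ≤ a x ^ 2 * r ^ 2)
      linarith
    linarith
  unfold gradSq
  rw [e, e]
  linarith [key (fderiv ℝ a x (1, 0)) (fderiv ℝ b x (1, 0)) (fderiv ℝ c x (1, 0)),
    key (fderiv ℝ a x (0, 1)) (fderiv ℝ b x (0, 1)) (fderiv ℝ c x (0, 1))]

/-- The boundary cutoff costs `O(ε)` when weighted by a function vanishing at the boundary. -/
lemma exists_integral_boundaryCutoff_le {φ : ℝ × ℝ → ℝ} (hφ : Continuous φ) {R L : ℝ}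
    (hR : 0 < R) (hL : 0 < L)
    (hφL : ∀ x ∈ disk R, φ x ^ 2 ≤ L * (R ^ 2 - (x.1 ^ 2 + x.2 ^ 2)) ^ 2) :
    ∃ C, 0 < C ∧ ∀ ε, 0 < ε → ∫ x, φ x ^ 2 * gradSq (boundaryCutoff R ε) x ≤ C * ε := by
  obtain ⟨B, hB0, hB, hB'⟩ := exists_bound_deriv_smoothTransition
  refine ⟨π * (144 * L * R ^ 2 * B), by positivity, fun ε hε => ?_⟩
  have hgc := continuous_gradSq (contDiff_boundaryCutoff R ε)
  have hz : ∀ x : ℝ × ℝ, R ^ 2 ≤ x.1 ^ 2 + x.2 ^ 2 →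
      φ x ^ 2 * gradSq (boundaryCutoff R ε) x = 0 := by
    intro x hx
    rw [gradSq_boundaryCutoff R hε.ne', hB' _ fun h => ?_]
    · simp
    · have : (R ^ 2 - (x.1 ^ 2 + x.2 ^ 2)) / ε ≤ 0 :=
        div_nonpos_of_nonpos_of_nonneg (by linarith) hε.le
      linarith [h.1]
  refine (integral_le_of_radial_bound (R := R)
    (H := fun s => 144 * L * R ^ 2 * B * ε ^ 2 * (R ^ 2 - s + ε)⁻¹)
    (H' := fun s => 144 * L * R ^ 2 * B * ε ^ 2 / (R ^ 2 - s + ε) ^ 2)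
    (by fun_prop) hR hz ?_ ?_ ?_).trans ?_
  · intro s hs
    have hne : R ^ 2 - s + ε ≠ 0 := by linarith [hs.2]
    exact (((((hasDerivAt_id s).const_sub (R ^ 2)).add_const ε).inv hne).const_mul
      (144 * L * R ^ 2 * B * ε ^ 2)).congr_deriv (by simp; ring)
  · refine ContinuousOn.div (by fun_prop) (by fun_prop) fun s hs => ?_
    have : 0 < R ^ 2 - s + ε := by linarith [hs.2]
    positivity
  · intro x hx
    have hρε : 0 < R ^ 2 - (x.1 ^ 2 + x.2 ^ 2) + ε := by linarith
    by_cases hS : (R ^ 2 - (x.1 ^ 2 + x.2 ^ 2)) / ε - 1 ∈ Icc (0 : ℝ) 1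
    · have h1 : ε ≤ R ^ 2 - (x.1 ^ 2 + x.2 ^ 2) := by
        have := hS.1
        rwa [sub_nonneg, one_le_div hε] at this
      have h2 : R ^ 2 - (x.1 ^ 2 + x.2 ^ 2) ≤ 2 * ε := by
        have := hS.2
        rw [sub_le_iff_le_add, div_le_iff₀ hε] at this
        linarith
      have hxd : x ∈ disk R := show x.1 ^ 2 + x.2 ^ 2 < R ^ 2 by linarith
      have h3 : φ x ^ 2 ≤ L * (2 * ε) ^ 2 := (hφL x hxd).trans (by gcongr)
      have h4 : gradSq (boundaryCutoff R ε) x ≤ 4 * R ^ 2 * B / ε ^ 2 := by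
        rw [gradSq_boundaryCutoff R hε.ne']
        gcongr
        exact hB _
      have h5 := mul_le_mul h3 h4 (gradSq_nonneg _ _) (by positivity)
      refine h5.trans ?_
      rw [le_div_iff₀ (by positivity)]
      have h6 : (R ^ 2 - (x.1 ^ 2 + x.2 ^ 2) + ε) ^ 2 ≤ (3 * ε) ^ 2 :=
        pow_le_pow_left₀ hρε.le (by linarith) 2
      calc _ ≤ L * (2 * ε) ^ 2 * (4 * R ^ 2 * B / ε ^ 2) * (3 * ε) ^ 2 := by gcongr
        _ = _ := by field_simp; ring
    · rw [gradSq_boundaryCutoff R hε.ne', hB' _ hS]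
      simp only [ne_eq, OfNat.ofNat_ne_zero, not_false_eq_true, zero_pow, mul_zero, zero_div]
      positivity
  · simp only [sub_self, zero_add, sub_zero]
    have : 0 ≤ 144 * L * R ^ 2 * B * ε ^ 2 * (R ^ 2 + ε)⁻¹ := by positivity
    rw [mul_assoc π]
    gcongr
    refine (sub_le_self _ this).trans (le_of_eq ?_)
    field_simp

/-- The logarithmic cutoff costs `O(1 / |log δ|)`. -/
lemma exists_integral_logCutoff_le {R L : ℝ} (hR : 0 < R) (hL : 0 < L) :
    ∃ C, 0 < C ∧ ∀ K δ, 0 < K → 0 < δ → δ < 1 / 2 → ∀ ψ : ℝ × ℝ → ℝ, Continuous ψ →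
      (∀ x, ψ x ≤ L) → ∀ p : ℝ × ℝ, (∀ x, R ^ 2 ≤ x.1 ^ 2 + x.2 ^ 2 → ψ (x + p) = 0) →
      ∫ x, ψ x * gradSq (fun y => logCutoff K δ (y - p)) x ≤ C / |Real.log δ| := by
  obtain ⟨B, hB0, hB, -⟩ := exists_bound_deriv_smoothTransition
  have hlog2 : 0 < Real.log 2 := Real.log_pos (by norm_num)
  have hlogR : 0 < Real.log (R ^ 2 + 1) := Real.log_pos (by linarith [sq_pos_of_pos hR])
  refine ⟨π * (4 * L * B) * (Real.log (R ^ 2 + 1) / Real.log 2 + 2), by positivity, ?_⟩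
  intro K δ hK hδ hδ2 ψ hψ hψL p hp
  have hl := abs_log_ge_of_lt_half hδ hδ2
  have hl0 : 0 < |Real.log δ| := hlog2.trans_le hl
  set l := |Real.log δ| with hldef
  have hgc := continuous_gradSq (contDiff_logCutoff hK hδ)
  have e : ∫ x, ψ x * gradSq (fun y => logCutoff K δ (y - p)) x =
      ∫ x, ψ (x + p) * gradSq (logCutoff K δ) x := by
    rw [← integral_add_right_eq_self _ p]
    simp only [gradSq_comp_sub, add_sub_cancel_right]
  rw [e]
  refine (integral_le_of_radial_bound (R := R)
    (H := fun s => 4 * L * B / l ^ 2 * Real.log (s + δ ^ 2))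
    (H' := fun s => 4 * L * B / l ^ 2 / (s + δ ^ 2))
    (by fun_prop) hR (fun x hx => by rw [hp x hx, zero_mul]) ?_ ?_ ?_).trans ?_
  · intro s hs
    have hne : s + δ ^ 2 ≠ 0 := by have := hs.1; positivity
    exact ((((hasDerivAt_id s).add_const (δ ^ 2)).log hne).const_mul
      (4 * L * B / l ^ 2)).congr_deriv (by simp; ring)
  · refine ContinuousOn.div (by fun_prop) (by fun_prop) fun s hs => ?_
    have := hs.1
    positivity
  · intro x _
    have hs : 0 < x.1 ^ 2 + x.2 ^ 2 + δ ^ 2 := by positivity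
    have h1 : gradSq (logCutoff K δ) x ≤ 4 * B / l ^ 2 / (x.1 ^ 2 + x.2 ^ 2 + δ ^ 2) := by
      rw [gradSq_logCutoff hK hδ (by linarith), ← hldef]
      calc _ ≤ 4 * (x.1 ^ 2 + x.2 ^ 2 + δ ^ 2) * B / ((x.1 ^ 2 + x.2 ^ 2 + δ ^ 2) * l) ^ 2 := by
            refine div_le_div_of_nonneg_right ?_ (sq_nonneg _)
            exact mul_le_mul (by linarith [sq_nonneg δ]) (hB _) (sq_nonneg _) (by positivity)
        _ = _ := by field_simp
    calc _ ≤ L * (4 * B / l ^ 2 / (x.1 ^ 2 + x.2 ^ 2 + δ ^ 2)) := by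
          gcongr
          · exact gradSq_nonneg _ _
          · exact hψL _
      _ = _ := by ring
  · have h1 : Real.log (R ^ 2 + δ ^ 2) ≤ Real.log (R ^ 2 + 1) := by
      refine Real.log_le_log (by positivity) ?_
      have : δ ^ 2 ≤ 1 := pow_le_one₀ hδ.le (by linarith)
      linarith
    have h2 : Real.log (0 + δ ^ 2) = -(2 * l) := by
      rw [zero_add, Real.log_pow, hldef, abs_of_neg (Real.log_neg hδ (by linarith))]
      push_cast
      ring
    have h3 : Real.log (R ^ 2 + 1) ≤ Real.log (R ^ 2 + 1) / Real.log 2 * l := by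
      rw [div_mul_eq_mul_div, le_div_iff₀ hlog2]
      gcongr
    simp only [h2]
    rw [← mul_sub, sub_neg_eq_add]
    calc _ ≤ π * (4 * L * B / l ^ 2 * (Real.log (R ^ 2 + 1) / Real.log 2 * l + 2 * l)) := by
          gcongr
          exact h1.trans h3
      _ = _ := by field_simp

lemma hasCompactSupport_of_eq_zero {f : ℝ × ℝ → ℝ} {R : ℝ} (hR : 0 ≤ R)
    (h : ∀ x, R ^ 2 ≤ x.1 ^ 2 + x.2 ^ 2 → f x = 0) : HasCompactSupport f := by
  refine HasCompactSupport.of_support_subset_isCompact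
    (isCompact_closedBall (0 : ℝ × ℝ) R) fun x hx => ?_
  have hx' : x.1 ^ 2 + x.2 ^ 2 < R ^ 2 := by
    by_contra hc
    exact hx (h x (not_lt.1 hc))
  rw [mem_closedBall_zero_iff, Prod.norm_def, Real.norm_eq_abs, Real.norm_eq_abs]
  exact max_le (abs_le_of_sq_le_sq (by linarith [sq_nonneg x.2]) hR)
    (abs_le_of_sq_le_sq (by linarith [sq_nonneg x.1]) hR)

lemma dist_sq_le_of_mem_crackSet {R₁ δ : ℝ} {x : ℝ × ℝ} (hx : x ∈ crackSet R₁ δ) :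
    (x.1 ^ 2 + (x.2 - R₁) ^ 2 ≤ R₁ ^ 2 * δ ^ 2) ∨ (x.1 ^ 2 + (x.2 + R₁) ^ 2 ≤ R₁ ^ 2 * δ ^ 2) := by
  have key : ∀ t : ℝ, |t| ≤ δ → 2 * R₁ ^ 2 * (1 - cos t) ≤ R₁ ^ 2 * δ ^ 2 := by
    intro t ht
    have h1 := Real.one_sub_sq_div_two_le_cos (x := t)
    have h2 : t ^ 2 ≤ δ ^ 2 := sq_le_sq' (abs_le.1 ht).1 (abs_le.1 ht).2
    have h3 : 2 * (1 - cos t) ≤ δ ^ 2 := by linarith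
    have := mul_le_mul_of_nonneg_left h3 (sq_nonneg R₁)
    linarith
  obtain ⟨θ, hθ | hθ, rfl⟩ := hx
  · left
    have := key (θ - π / 2) (abs_le.2 ⟨by linarith [hθ.1], by linarith [hθ.2]⟩)
    rw [cos_sub_pi_div_two] at this
    refine le_trans (le_of_eq ?_) this
    linear_combination R₁ ^ 2 * sin_sq_add_cos_sq θ
  · right
    have := key (θ + π / 2) (abs_le.2 ⟨by linarith [hθ.1], by linarith [hθ.2]⟩)
    rw [cos_add_pi_div_two] at this
    refine le_trans (le_of_eq ?_) this
    linear_combination R₁ ^ 2 * sin_sq_add_cos_sq θ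

/-- The product of the boundary cutoff and of the logarithmic cutoffs around `(0, ± R₁)`. -/
def crackCutoff (R₁ R₂ δ : ℝ) (x : ℝ × ℝ) : ℝ :=
  boundaryCutoff R₂ δ x *
    (logCutoff (R₁ ^ 2 + 2) δ (x - (0, R₁)) * logCutoff (R₁ ^ 2 + 2) δ (x - (0, -R₁)))

lemma contDiff_crackCutoff (R₁ R₂ : ℝ) {δ : ℝ} (hδ : 0 < δ) :
    ContDiff ℝ (⊤ : ℕ∞) (crackCutoff R₁ R₂ δ) := by
  have h := contDiff_logCutoff (K := R₁ ^ 2 + 2) (by positivity) hδ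
  exact (contDiff_boundaryCutoff R₂ δ).mul
    ((h.comp (contDiff_id.sub contDiff_const)).mul (h.comp (contDiff_id.sub contDiff_const)))

lemma testFun_crackCutoff {R₁ R₂ δ : ℝ} (hR₂ : 0 < R₂) (hδ : 0 < δ) :
    testFun (disk R₂ \ crackSet R₁ δ) (crackCutoff R₁ R₂ δ) := by
  have hK : 0 < R₁ ^ 2 + 2 := by positivity
  refine ⟨contDiff_crackCutoff R₁ R₂ hδ, hasCompactSupport_of_eq_zero hR₂.le fun x hx => ?_, ?_⟩
  · rw [crackCutoff, boundaryCutoff_eq_zero hδ (by linarith), zero_mul]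
  · have hcl : IsClosed {x : ℝ × ℝ | δ ≤ R₂ ^ 2 - (x.1 ^ 2 + x.2 ^ 2) ∧
        (R₁ ^ 2 + 2) * δ ^ 2 ≤ x.1 ^ 2 + (x.2 - R₁) ^ 2 + δ ^ 2 ∧
        (R₁ ^ 2 + 2) * δ ^ 2 ≤ x.1 ^ 2 + (x.2 + R₁) ^ 2 + δ ^ 2} := by
      simp only [ofPred_and]
      exact (isClosed_le (by fun_prop) (by fun_prop)).inter
        ((isClosed_le (by fun_prop) (by fun_prop)).inter (isClosed_le (by fun_prop) (by fun_prop)))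
    have hsub : tsupport (crackCutoff R₁ R₂ δ) ⊆ _ := closure_minimal (fun x hx => ?_) hcl
    · refine hsub.trans fun x hx => ⟨show x.1 ^ 2 + x.2 ^ 2 < R₂ ^ 2 by linarith [hx.1],
        fun hxc => ?_⟩
      have hδ2 : 0 < δ ^ 2 := by positivity
      rcases dist_sq_le_of_mem_crackSet hxc with h | h
      · linarith [hx.2.1]
      · linarith [hx.2.2]
    · have hx' : crackCutoff R₁ R₂ δ x ≠ 0 := hx
      refine ⟨?_, ?_, ?_⟩ <;> by_contra hc <;> rw [not_le] at hc <;> refine hx' ?_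
      · rw [crackCutoff, boundaryCutoff_eq_zero hδ hc.le, zero_mul]
      · rw [crackCutoff, logCutoff_eq_zero hK hδ (x := x - (0, R₁)) (by simpa using hc.le)]
        simp
      · rw [crackCutoff, logCutoff_eq_zero hK hδ (x := x - (0, -R₁)) (by simpa using hc.le)]
        simp

lemma crackCutoff_eq_one {R₁ R₂ δ : ℝ} (hR₁ : 0 < R₁) (hR₁₂ : R₁ < R₂) (hδ : 0 < δ) (hδ1 : δ < 1)
    (hδR : (R₁ ^ 2 + 2) * δ ≤ R₁ ^ 2 / 4) {x : ℝ × ℝ} (hx : x.1 ^ 2 + x.2 ^ 2 < (R₁ / 2) ^ 2) :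
    crackCutoff R₁ R₂ δ x = 1 := by
  have hK : 0 < R₁ ^ 2 + 2 := by positivity
  have hx2 := abs_lt_of_sq_lt_sq' (by linarith [sq_nonneg x.1] : x.2 ^ 2 < (R₁ / 2) ^ 2)
    (by positivity)
  have hR : R₁ ^ 2 ≤ R₂ ^ 2 := pow_le_pow_left₀ hR₁.le hR₁₂.le 2
  have h1 : (R₁ / 2) ^ 2 ≤ (R₁ - x.2) ^ 2 := pow_le_pow_left₀ (by positivity) (by linarith) 2
  have h2 : (R₁ / 2) ^ 2 ≤ (R₁ + x.2) ^ 2 := pow_le_pow_left₀ (by positivity) (by linarith) 2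
  have hRδ : 0 ≤ R₁ ^ 2 * δ := by positivity
  rw [crackCutoff, boundaryCutoff_eq_one hδ (by nlinarith),
    logCutoff_eq_one hK hδ hδ1 (x := x - (0, R₁)) ?_,
    logCutoff_eq_one hK hδ hδ1 (x := x - (0, -R₁)) ?_]
  · simp
  · simp
    nlinarith [sq_nonneg x.1, sq_nonneg δ]
  · simp
    nlinarith [sq_nonneg x.1, sq_nonneg δ]

lemma exists_integral_gradSq_crackCutoff_le {φ : ℝ × ℝ → ℝ} (hφ : Continuous φ) {R₁ R₂ L : ℝ}
    (hR₁ : 0 < R₁) (hR₁₂ : R₁ < R₂) (hL : 0 < L)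
    (hφL : ∀ x ∈ disk R₂, φ x ^ 2 ≤ L * (R₂ ^ 2 - (x.1 ^ 2 + x.2 ^ 2)) ^ 2) :
    ∃ C, 0 < C ∧ ∀ δ, 0 < δ → δ < 1 / 2 →
      ∫ x, φ x ^ 2 * gradSq (crackCutoff R₁ R₂ δ) x ≤ C / |Real.log δ| := by
  have hR₂ : 0 < R₂ := hR₁.trans hR₁₂
  obtain ⟨C₁, hC₁, H₁⟩ := exists_integral_boundaryCutoff_le hφ hR₂ hL hφL
  obtain ⟨C₂, hC₂, H₂⟩ := exists_integral_logCutoff_le (R := 2 * R₂) (L := L * R₂ ^ 4)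
    (by positivity) (by positivity)
  refine ⟨3 * (C₁ + C₂ + C₂), by positivity, fun δ hδ hδ2 => ?_⟩
  have hK : 0 < R₁ ^ 2 + 2 := by positivity
  have hRR : R₁ ^ 2 ≤ R₂ ^ 2 := pow_le_pow_left₀ hR₁.le hR₁₂.le 2
  have hl0 : 0 < |Real.log δ| := abs_pos.2 (Real.log_neg hδ (by linarith)).ne
  set b := boundaryCutoff R₂ δ with hb
  have hbs : ContDiff ℝ (⊤ : ℕ∞) b := contDiff_boundaryCutoff R₂ δ
  have hls : ∀ p : ℝ × ℝ, ContDiff ℝ (⊤ : ℕ∞) fun y => logCutoff (R₁ ^ 2 + 2) δ (y - p) := fun p =>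
    (contDiff_logCutoff hK hδ).comp (contDiff_id.sub contDiff_const)
  have hbc := hbs.continuous
  have hgb := continuous_gradSq hbs
  have hgl := fun p => continuous_gradSq (hls p)
  have hb0 : ∀ x : ℝ × ℝ, R₂ ^ 2 ≤ x.1 ^ 2 + x.2 ^ 2 → b x = 0 := fun x hx =>
    boundaryCutoff_eq_zero hδ (by linarith)
  have hbcs : HasCompactSupport b := hasCompactSupport_of_eq_zero hR₂.le hb0
  set ψ : ℝ × ℝ → ℝ := fun x => φ x ^ 2 * b x ^ 2 with hψ
  have hψ0 : ∀ x : ℝ × ℝ, R₂ ^ 2 ≤ x.1 ^ 2 + x.2 ^ 2 → ψ x = 0 := fun x hx => by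
    simp [hψ, hb0 x hx]
  have hψc : Continuous ψ := by fun_prop
  have hψcs : HasCompactSupport ψ := hasCompactSupport_of_eq_zero hR₂.le hψ0
  have hψL : ∀ x, ψ x ≤ L * R₂ ^ 4 := by
    intro x
    by_cases hx : x ∈ disk R₂
    · have hx' : x.1 ^ 2 + x.2 ^ 2 < R₂ ^ 2 := hx
      have h1 := hφL x hx
      have h2 : (R₂ ^ 2 - (x.1 ^ 2 + x.2 ^ 2)) ^ 2 ≤ (R₂ ^ 2) ^ 2 :=
        pow_le_pow_left₀ (by linarith) (by linarith [sq_nonneg x.1, sq_nonneg x.2]) 2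
      have h3 := mul_le_mul_of_nonneg_left h2 hL.le
      have h4 := mul_le_mul_of_nonneg_left
        (sq_smoothTransition_le_one ((R₂ ^ 2 - (x.1 ^ 2 + x.2 ^ 2)) / δ - 1)) (sq_nonneg (φ x))
      calc ψ x ≤ φ x ^ 2 * 1 := h4
        _ ≤ L * (R₂ ^ 2) ^ 2 := by linarith
        _ = _ := by ring
    · rw [hψ0 x (not_lt.1 hx)]
      positivity
  have hψt : ∀ q : ℝ, q ^ 2 = R₁ ^ 2 → ∀ x : ℝ × ℝ, (2 * R₂) ^ 2 ≤ x.1 ^ 2 + x.2 ^ 2 →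
      ψ (x + (0, q)) = 0 := by
    intro q hq x hx
    refine hψ0 _ ?_
    simp only [Prod.fst_add, Prod.snd_add, add_zero]
    linarith [sq_nonneg (x.2 + 2 * q), sq_nonneg x.1]
  have I₁ := H₁ δ hδ
  have I₂ := H₂ _ δ hK hδ hδ2 ψ hψc hψL (0, R₁) (hψt _ rfl)
  have I₃ := H₂ _ δ hK hδ hδ2 ψ hψc hψL (0, -R₁) (hψt _ (by ring))
  have i₁ : Integrable fun x => φ x ^ 2 * gradSq b x :=
    Continuous.integrable_of_hasCompactSupport (by fun_prop)
      (hasCompactSupport_gradSq hbcs).mul_left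
  have i₂ : ∀ p, Integrable fun x => ψ x * gradSq (fun y => logCutoff (R₁ ^ 2 + 2) δ (y - p)) x :=
    fun p => Continuous.integrable_of_hasCompactSupport (hψc.mul (hgl p)) hψcs.mul_right
  have i₁₂ : Integrable fun x => φ x ^ 2 * gradSq b x +
      ψ x * gradSq (fun y => logCutoff (R₁ ^ 2 + 2) δ (y - (0, R₁))) x := i₁.add (i₂ _)
  have hχ := testFun_crackCutoff (R₁ := R₁) hR₂ hδ
  have hgχ := continuous_gradSq hχ.1
  have i₀ : Integrable fun x => φ x ^ 2 * gradSq (crackCutoff R₁ R₂ δ) x :=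
    Continuous.integrable_of_hasCompactSupport (by fun_prop)
      (hasCompactSupport_gradSq hχ.2.1).mul_left
  have hδl : C₁ * δ ≤ C₁ / |Real.log δ| := by
    rw [le_div_iff₀ hl0, mul_assoc]
    refine mul_le_of_le_one_right hC₁.le ?_
    have h1 := Real.log_le_sub_one_of_pos (inv_pos.2 hδ)
    rw [Real.log_inv] at h1
    rw [abs_of_neg (Real.log_neg hδ (by linarith))]
    have h2 := mul_le_mul_of_nonneg_left h1 hδ.le
    rw [mul_sub, mul_inv_cancel₀ hδ.ne'] at h2
    linarith
  calc ∫ x, φ x ^ 2 * gradSq (crackCutoff R₁ R₂ δ) x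
      ≤ ∫ x, 3 * (φ x ^ 2 * gradSq b x +
          ψ x * gradSq (fun y => logCutoff (R₁ ^ 2 + 2) δ (y - (0, R₁))) x +
          ψ x * gradSq (fun y => logCutoff (R₁ ^ 2 + 2) δ (y - (0, -R₁))) x) := by
        refine integral_mono i₀ ((i₁₂.add (i₂ _)).const_mul 3) fun x => ?_
        have h := gradSq_mul_mul_le (hbs.differentiable (by simp) x)
          ((hls (0, R₁)).differentiable (by simp) x) ((hls (0, -R₁)).differentiable (by simp) x)
          (sq_smoothTransition_le_one _) (sq_smoothTransition_le_one _)
        refine (mul_le_mul_of_nonneg_left h (sq_nonneg (φ x))).trans (le_of_eq ?_)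
        simp only [hψ]
        ring
    _ ≤ 3 * (C₁ / |Real.log δ| + C₂ / |Real.log δ| + C₂ / |Real.log δ|) := by
        rw [integral_const_mul, integral_add i₁₂ (i₂ _), integral_add i₁ (i₂ _)]
        linarith
    _ = _ := by ring

lemma exists_le_integral_crackCutoff {φ : ℝ × ℝ → ℝ} (hφ : Continuous φ) {R₁ R₂ : ℝ}
    (hR₁ : 0 < R₁) (hR₁₂ : R₁ < R₂) (hφ0 : φ 0 ≠ 0) :
    ∃ c, 0 < c ∧ ∀ δ, 0 < δ → δ < 1 → (R₁ ^ 2 + 2) * δ ≤ R₁ ^ 2 / 4 →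
      c ≤ ∫ x, (φ x * crackCutoff R₁ R₂ δ x) ^ 2 := by
  have hR₂ : 0 < R₂ := hR₁.trans hR₁₂
  have hε : 0 < (R₁ / 2) ^ 2 / 2 := by positivity
  set b := boundaryCutoff (R₁ / 2) ((R₁ / 2) ^ 2 / 2) with hb
  have hbc : Continuous b := (contDiff_boundaryCutoff _ _).continuous
  have hb0 : ∀ x : ℝ × ℝ, (R₁ / 2) ^ 2 ≤ x.1 ^ 2 + x.2 ^ 2 → b x = 0 := fun x hx =>
    boundaryCutoff_eq_zero hε (by linarith)
  have hbs : HasCompactSupport b := hasCompactSupport_of_eq_zero (by positivity) hb0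
  have hφb : Continuous fun x => φ x * b x := by fun_prop
  have hne : (fun x => φ x * b x) ≠ 0 := fun h => by
    have h0 := congrFun h 0
    have hb1 : b 0 = 1 := boundaryCutoff_eq_one hε (by simp; linarith)
    simp [hb1, hφ0] at h0
  refine ⟨_, integral_sq_pos hφb hbs.mul_left hne, fun δ hδ hδ1 hδR => ?_⟩
  have hχ := testFun_crackCutoff (R₁ := R₁) hR₂ hδ
  have hχc := hχ.1.continuous
  have hsq : ∀ {f : ℝ × ℝ → ℝ}, HasCompactSupport f → HasCompactSupport fun x => f x ^ 2 :=
    fun h => h.comp_left (g := fun t : ℝ => t ^ 2) (by simp)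
  refine integral_mono (Continuous.integrable_of_hasCompactSupport (by fun_prop) (hsq hbs.mul_left))
    (Continuous.integrable_of_hasCompactSupport (by fun_prop) (hsq hχ.2.1.mul_left)) fun x => ?_
  by_cases hx : x.1 ^ 2 + x.2 ^ 2 < (R₁ / 2) ^ 2
  · simp only [crackCutoff_eq_one hR₁ hR₁₂ hδ hδ1 hδR hx, mul_one, mul_pow]
    exact mul_le_of_le_one_right (sq_nonneg _) (sq_smoothTransition_le_one _)
  · simpa [hb0 x (not_lt.1 hx)] using sq_nonneg (φ x * crackCutoff R₁ R₂ δ x)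

lemma testFun.mono {ω ω' : Set (ℝ × ℝ)} (h : ω ⊆ ω') {u : ℝ × ℝ → ℝ} (hu : testFun ω u) :
    testFun ω' u :=
  ⟨hu.1, hu.2.1, hu.2.2.trans h⟩

lemma lambda1_le_rayleigh {ω : Set (ℝ × ℝ)} {u : ℝ × ℝ → ℝ} (hu : testFun ω u) (h0 : u ≠ 0) :
    lambda1 ω ≤ rayleigh ω u :=
  csInf_le (bddBelow_rayleigh ω) ⟨u, hu, h0, rfl⟩

/-- Enlarging the domain lowers the first eigenvalue. -/
lemma lambda1_anti {ω ω' : Set (ℝ × ℝ)} (h : ω ⊆ ω') (hne : ∃ u, testFun ω u ∧ u ≠ 0) :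
    lambda1 ω' ≤ lambda1 ω := by
  obtain ⟨u, hu, h0⟩ := hne
  refine le_csInf ⟨_, u, hu, h0, rfl⟩ ?_
  rintro r ⟨v, hv, hv0, rfl⟩
  rw [rayleigh_eq hv, ← rayleigh_eq (hv.mono h)]
  exact lambda1_le_rayleigh (hv.mono h) hv0

/-- the eigenvalue shift `λ₁(B_{R₂} \ K_δ) − λ₁(B_{R₂})` is of the exact
order `1/|log δ|` as `δ → 0⁺`. -/
theorem NND_shift_log_order (R₁ R₂ : ℝ) (hR₁ : 0 < R₁) (hR₁₂ : R₁ < R₂) :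
    ∃ c C δ₀ : ℝ, 0 < c ∧ 0 < C ∧ δ₀ ∈ Set.Ioo (0 : ℝ) 1 ∧
      ∀ δ ∈ Set.Ioo (0 : ℝ) δ₀,
        c / |Real.log δ| ≤ lambda1 (disk R₂ \ crackSet R₁ δ) - lambda1 (disk R₂) ∧
        lambda1 (disk R₂ \ crackSet R₁ δ) - lambda1 (disk R₂) ≤ C / |Real.log δ| := by
  have hR₂ : 0 < R₂ := hR₁.trans hR₁₂
  obtain ⟨t₀, m, M, ht₀, hm, hM, hb⟩ := exists_first_zero_besselSeries
  obtain ⟨A, hA, hP⟩ := weighted_poincare hR₁ hR₁₂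
  set κ := t₀ / R₂ ^ 2 with hκdef
  have hκ : 0 < κ := by positivity
  have hφs := contDiff_groundState κ
  have hφ0 : groundState κ 0 ≠ 0 :=
    (groundState_pos ht₀ hm hR₂ hb
      (show (0 : ℝ × ℝ) ∈ disk R₂ by simpa [disk] using pow_pos hR₂ 2)).ne'
  obtain ⟨C, hC, hCle⟩ := exists_integral_gradSq_crackCutoff_le hφs.continuous hR₁ hR₁₂
    (L := (M * κ) ^ 2) (by positivity) fun x hx => by
      rw [← mul_pow]
      exact pow_le_pow_left₀ (groundState_pos ht₀ hm hR₂ hb hx).le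
        (groundState_bounds ht₀ hR₂ hb hx).2 2
  obtain ⟨c, hc, hcle⟩ := exists_le_integral_crackCutoff hφs.continuous hR₁ hR₁₂ hφ0
  have hK : 0 < R₁ ^ 2 + 2 := by positivity
  have hd₀ : 0 < R₁ ^ 2 / 4 / (R₁ ^ 2 + 2) := by positivity
  set δ₀ := min (1 / 2) (R₁ ^ 2 / 4 / (R₁ ^ 2 + 2)) with hδ₀
  have hδ₀pos : 0 < δ₀ := lt_min (by norm_num) hd₀
  have hlog : ∀ δ ∈ Ioo 0 δ₀, 0 < |Real.log δ| := fun δ hδ =>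
    abs_pos.2 (Real.log_neg hδ.1 (by linarith [hδ.2.trans_le (min_le_left _ _)])).ne
  have upper : ∀ δ ∈ Ioo 0 δ₀, ∃ u, testFun (disk R₂ \ crackSet R₁ δ) u ∧ u ≠ 0 ∧
      rayleigh (disk R₂ \ crackSet R₁ δ) u ≤ 4 * κ + C / c / |Real.log δ| := by
    intro δ hδ
    have hδ2 : δ < 1 / 2 := hδ.2.trans_le (min_le_left _ _)
    have hδR : (R₁ ^ 2 + 2) * δ ≤ R₁ ^ 2 / 4 := by
      rw [mul_comm, ← le_div_iff₀ hK]
      exact (hδ.2.trans_le (min_le_right _ _)).le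
    have hχ := testFun_crackCutoff (R₁ := R₁) hR₂ hδ.1
    have h1 := hCle δ hδ.1 hδ2
    have h2 := hcle δ hδ.1 (by linarith) hδR
    have hu : testFun (disk R₂ \ crackSet R₁ δ)
        fun x => groundState κ x * crackCutoff R₁ R₂ δ x :=
      ⟨hφs.mul hχ.1, hχ.2.1.mul_left, (tsupport_mul_subset_right).trans hχ.2.2⟩
    have hI := hc.trans_le h2
    refine ⟨_, hu, fun h => ?_, ?_⟩
    · have h0 : ∀ x, groundState κ x * crackCutoff R₁ R₂ δ x = 0 := congrFun h
      simp [h0] at hI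
    · rw [rayleigh_eq hu, integral_gradSq_groundState_mul κ hχ.1 hχ.2.1, div_le_iff₀ hI, add_mul]
      gcongr
      refine h1.trans ?_
      rw [div_right_comm, div_mul_eq_mul_div, le_div_iff₀ hc]
      exact mul_le_mul_of_nonneg_left h2 (div_pos hC (hlog δ hδ)).le
  have lower : ∀ δ ∈ Ioo 0 δ₀, 4 * κ + m ^ 2 / (M ^ 2 * A) / |Real.log δ| ≤
      lambda1 (disk R₂ \ crackSet R₁ δ) := by
    intro δ hδ
    obtain ⟨u, hu, h0, -⟩ := upper δ hδ
    refine le_csInf ⟨_, u, hu, h0, rfl⟩ ?_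
    rintro r ⟨v, hv, hv0, rfl⟩
    have := le_rayleigh_of_weighted_poincare ht₀ hm hM hR₂ (mul_pos hA (hlog δ hδ)) hb
      sdiff_subset (hP δ hδ.1 (hδ.2.trans_le (min_le_left _ _))) hv hv0
    rwa [← mul_assoc, ← div_div] at this
  have hdisk_le : lambda1 (disk R₂) ≤ 4 * κ := by
    refine le_of_forall_pos_le_add fun ε hε => ?_
    have hlim : Filter.Tendsto (fun δ => C / c / |Real.log δ|) (nhdsWithin 0 (Ioi 0)) (nhds 0) :=
      (Filter.tendsto_abs_atBot_atTop.comp Real.tendsto_log_nhdsGT_zero).const_div_atTop _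
    obtain ⟨δ, hδε, hδ⟩ :=
      ((hlim.eventually (gt_mem_nhds hε)).and (Ioo_mem_nhdsGT hδ₀pos)).exists
    obtain ⟨u, hu, h0, hle⟩ := upper δ hδ
    calc lambda1 (disk R₂) ≤ lambda1 (disk R₂ \ crackSet R₁ δ) :=
          lambda1_anti sdiff_subset ⟨u, hu, h0⟩
      _ ≤ _ := (lambda1_le_rayleigh hu h0).trans hle
      _ ≤ 4 * κ + ε := by gcongr
  have hle_disk : 4 * κ ≤ lambda1 (disk R₂) := by
    obtain ⟨u, hu, h0, -⟩ := upper (δ₀ / 2) ⟨by positivity, by linarith⟩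
    refine le_csInf ⟨_, u, hu.mono sdiff_subset, h0, rfl⟩ ?_
    rintro r ⟨v, hv, hv0, rfl⟩
    obtain ⟨w, hw, rfl⟩ := exists_eq_mul_of_testFun hv hφs
      fun x hx => (groundState_pos ht₀ hm hR₂ hb hx).ne'
    have hpos := integral_sq_pos hv.1.continuous hv.2.1 hv0
    rw [rayleigh_eq hv, le_div_iff₀ hpos, integral_gradSq_groundState_mul κ hw.1 hw.2.1]
    exact le_add_of_nonneg_right
      (integral_nonneg fun x => mul_nonneg (sq_nonneg _) (gradSq_nonneg w x))
  have hdisk : lambda1 (disk R₂) = 4 * κ := le_antisymm hdisk_le hle_disk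
  refine ⟨m ^ 2 / (M ^ 2 * A), C / c, δ₀, by positivity, by positivity,
    ⟨hδ₀pos, (min_le_left _ _).trans_lt (by norm_num)⟩, fun δ hδ => ⟨?_, ?_⟩⟩
  · rw [hdisk]
    linarith [lower δ hδ]
  · obtain ⟨u, hu, h0, hle⟩ := upper δ hδ
    rw [hdisk]
    linarith [lambda1_le_rayleigh hu h0]
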